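/- arXiv:math/0703273 — 10 statements merged into one kernel-verified Lean document; each statement's English description precedes it below -/
import Mathlib

section
/- For every integer n ≥ 1, the function f_n is smooth on ℝ and satisfies the linear ordinary differential equation f_n''(z) + (z/2) f_n'(z) + (1 - 2^{-(n+1)}) f_n(z) = 0 for all z ∈ ℝ. -/
open MeasureTheory Real Filter

/-- `f_n(z) = ∫_z^∞ ξ e^{-ξ²/4} (ξ - z)^{2^{-n} - 1} dξ`. -/
noncomputable def fn (n : ℕ) (z : ℝ) : ℝ :=
  ∫ ξ in Set.Ioi z, ξ * Real.exp (-ξ^2/4) * (ξ - z) ^ ((2:ℝ)^(-(n:ℝ)) - 1)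

/-- polynomial times Gaussian -/
noncomputable def gP (P : Polynomial ℝ) (x : ℝ) : ℝ := P.eval x * Real.exp (-x^2/4)

noncomputable def dP (P : Polynomial ℝ) : Polynomial ℝ :=
  Polynomial.derivative P - Polynomial.C (1/2) * Polynomial.X * P

noncomputable def KP (a : ℝ) (P : Polynomial ℝ) (z : ℝ) : ℝ :=
  ∫ t in Set.Ioi (0:ℝ), gP P (z + t) * t ^ (a - 1)

lemma gP_bound (P : Polynomial ℝ) : ∃ C : ℝ, 0 ≤ C ∧ ∀ x, |gP P x| ≤ C * Real.exp (-x) := by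
  induction P using Polynomial.induction_on' with
  | add p q hp hq =>
    obtain ⟨C, hC, h⟩ := hp
    obtain ⟨D, hD, h'⟩ := hq
    refine ⟨C + D, by positivity, fun x => ?_⟩
    have : gP (p + q) x = gP p x + gP q x := by
      simp [gP, add_mul]
    rw [this, add_mul]
    exact (abs_add_le _ _).trans (add_le_add (h x) (h' x))
  | monomial n c =>
    refine ⟨|c| * n.factorial * Real.exp 4, by positivity, fun x => ?_⟩
    have h1 : |x| ^ n ≤ n.factorial * Real.exp |x| := by
      have := Real.pow_div_factorial_le_exp |x| (abs_nonneg x) n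
      rw [div_le_iff₀ (by positivity)] at this
      linarith
    have h2 : Real.exp |x| * Real.exp (-x^2/4) ≤ Real.exp 4 * Real.exp (-x) := by
      rw [← Real.exp_add, ← Real.exp_add]
      apply Real.exp_le_exp.2
      have := le_abs_self x
      nlinarith [sq_abs x, sq_nonneg (|x| - 4)]
    have : |gP (Polynomial.monomial n c) x| = |c| * (|x| ^ n * Real.exp (-x^2/4)) := by
      simp [gP, abs_mul, mul_assoc]
    rw [this]
    have h3 : |x| ^ n * Real.exp (-x^2/4) ≤ n.factorial * (Real.exp 4 * Real.exp (-x)) := by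
      calc _ ≤ n.factorial * Real.exp |x| * Real.exp (-x^2/4) := by gcongr
        _ = n.factorial * (Real.exp |x| * Real.exp (-x^2/4)) := by ring
        _ ≤ _ := by gcongr
    calc _ ≤ |c| * (n.factorial * (Real.exp 4 * Real.exp (-x))) := by gcongr
      _ = _ := by ring

lemma gP_cont (P : Polynomial ℝ) : Continuous (gP P) := by
  unfold gP
  have := P.continuous
  fun_prop

lemma gP_deriv (P : Polynomial ℝ) (x : ℝ) : HasDerivAt (gP P) (gP (dP P) x) x := by
  have h1 := P.hasDerivAt x
  have h2 : HasDerivAt (fun x : ℝ => Real.exp (-x^2/4)) (Real.exp (-x^2/4) * (-(2*x)/4)) x := by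
    have := (((hasDerivAt_pow 2 x).neg).div_const 4).exp
    simpa using this
  refine (h1.mul h2).congr_deriv ?_
  simp [gP, dP]
  ring

lemma kp_meas (a z : ℝ) (P : Polynomial ℝ) :
    AEStronglyMeasurable (fun t : ℝ => gP P (z + t) * t ^ (a - 1))
      (volume.restrict (Set.Ioi (0:ℝ))) := by
  have := (gP_cont P).measurable
  apply Measurable.aestronglyMeasurable
  fun_prop

lemma kp_bound (a : ℝ) (P : Polynomial ℝ) : ∃ C : ℝ, 0 ≤ C ∧ ∀ z t : ℝ, 0 < t →
    |gP P (z + t) * t ^ (a - 1)| ≤ C * Real.exp (-z) * (Real.exp (-t) * t ^ (a - 1)) := by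
  obtain ⟨C, hC, h⟩ := gP_bound P
  refine ⟨C, hC, fun z t ht => ?_⟩
  rw [abs_mul, abs_of_nonneg (Real.rpow_nonneg ht.le _)]
  have := h (z + t)
  rw [neg_add, Real.exp_add] at this
  calc _ ≤ C * (Real.exp (-z) * Real.exp (-t)) * t ^ (a - 1) := by gcongr
    _ = _ := by ring

lemma kp_int (a z : ℝ) (ha : 0 < a) (P : Polynomial ℝ) :
    IntegrableOn (fun t : ℝ => gP P (z + t) * t ^ (a - 1)) (Set.Ioi (0:ℝ)) := by
  obtain ⟨C, hC, h⟩ := kp_bound a P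
  refine Integrable.mono' ((Real.GammaIntegral_convergent ha).const_mul (C * Real.exp (-z)))
    (kp_meas a z P) ?_
  filter_upwards [ae_restrict_mem measurableSet_Ioi] with t ht
  exact h z t ht

lemma KP_deriv (a : ℝ) (ha : 0 < a) (P : Polynomial ℝ) (z : ℝ) :
    HasDerivAt (KP a P) (KP a (dP P) z) z := by
  obtain ⟨C, hC, h⟩ := kp_bound a (dP P)
  refine (hasDerivAt_integral_of_dominated_loc_of_deriv_le
    (μ := volume.restrict (Set.Ioi (0:ℝ)))
    (F := fun z t => gP P (z + t) * t ^ (a - 1))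
    (F' := fun z t => gP (dP P) (z + t) * t ^ (a - 1))
    (bound := fun t => C * Real.exp (1 - z) * (Real.exp (-t) * t ^ (a - 1)))
    (s := Set.Ioi (z - 1)) (Ioi_mem_nhds (by linarith)) (Eventually.of_forall fun x => kp_meas a x P)
    (kp_int a z ha P) (kp_meas a z _) ?_
    ((Real.GammaIntegral_convergent ha).const_mul _) ?_).2
  · filter_upwards [ae_restrict_mem measurableSet_Ioi] with t ht x hx
    have ht' : (0:ℝ) < t := ht
    have hx' : z - 1 < x := hx
    refine (h x t ht).trans ?_
    gcongr
    linarith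
  · filter_upwards with t x hx
    exact ((gP_deriv P (x + t)).comp_add_const x t).mul_const _

lemma KP_contDiff (a : ℝ) (ha : 0 < a) (n : ℕ) : ∀ P, ContDiff ℝ n (KP a P) := by
  have hd : ∀ P, Differentiable ℝ (KP a P) := fun P z => (KP_deriv a ha P z).differentiableAt
  have he : ∀ P, deriv (KP a P) = KP a (dP P) := fun P => funext fun z => (KP_deriv a ha P z).deriv
  induction n with
  | zero => intro P; exact contDiff_zero.2 (hd P).continuous
  | succ n ih =>
    intro P
    push_cast
    rw [contDiff_succ_iff_deriv]
    refine ⟨hd P, by simp, ?_⟩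
    rw [he]
    exact ih _

lemma KP_ibp (a : ℝ) (ha : 0 < a) (P : Polynomial ℝ) (z : ℝ) :
    ∫ t in Set.Ioi (0:ℝ), (gP (dP P) (z + t) * t ^ a + gP P (z + t) * (a * t ^ (a - 1))) = 0 := by
  have hc := gP_cont P
  rw [integral_Ioi_of_hasDerivAt_of_tendsto (f := fun t => gP P (z + t) * t ^ a) (m := 0)]
  · simp [Real.zero_rpow ha.ne']
  · have : Continuous fun t : ℝ => t ^ a := Real.continuous_rpow_const ha.le
    exact Continuous.continuousWithinAt (by fun_prop)
  · intro t ht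
    have ht' : (0:ℝ) < t := ht
    exact ((gP_deriv P (z + t)).comp_const_add z t).mul
      (Real.hasDerivAt_rpow_const (Or.inl ht'.ne'))
  · refine Integrable.add ?_ ?_
    · have := kp_int (a + 1) z (by linarith) (dP P)
      simp only [add_sub_cancel_right] at this
      exact this
    · have := (kp_int a z ha P).const_mul a
      refine this.congr (Eventually.of_forall fun t => ?_)
      simp only
      ring
  · obtain ⟨C, hC, h⟩ := kp_bound (a + 1) P
    have h0 := (tendsto_rpow_mul_exp_neg_mul_atTop_nhds_zero a 1 one_pos).const_mul
      (C * Real.exp (-z))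
    rw [mul_zero] at h0
    refine squeeze_zero_norm' ?_ h0
    filter_upwards [eventually_gt_atTop 0] with t ht
    have := h z t ht
    simp only [add_sub_cancel_right] at this
    rw [Real.norm_eq_abs]
    refine this.trans (le_of_eq ?_)
    ring_nf

lemma fn_eq (n : ℕ) : fn n = KP ((2:ℝ)^(-(n:ℝ))) Polynomial.X := by
  funext z
  unfold fn KP
  have := (measurePreserving_add_left volume z).setIntegral_preimage_emb
    (measurableEmbedding_addLeft z)
    (fun ξ => ξ * Real.exp (-ξ^2/4) * (ξ - z) ^ ((2:ℝ)^(-(n:ℝ)) - 1)) (Set.Ioi z)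
  rw [← this]
  simp [gP]

/-- For every integer `n ≥ 1`, the function `f_n` is smooth on `ℝ` and satisfies
`f_n''(z) + (z/2) f_n'(z) + (1 - 2^{-(n+1)}) f_n(z) = 0` for all `z ∈ ℝ`. -/
theorem stmt_1 (n : ℕ) (hn : 1 ≤ n) :
    ContDiff ℝ (⊤ : ℕ∞) (fn n) ∧
    ∀ z : ℝ, deriv (deriv (fn n)) z + z/2 * deriv (fn n) z
      + (1 - (2:ℝ)^(-(n:ℝ) - 1)) * fn n z = 0 := by
  rw [fn_eq, Real.rpow_sub_one (by norm_num)]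
  have ha : 0 < (2:ℝ)^(-(n:ℝ)) := by positivity
  generalize (2:ℝ)^(-(n:ℝ)) = a at ha
  refine ⟨contDiff_infty.2 fun m => KP_contDiff a ha m _, fun z => ?_⟩
  have he : ∀ P, deriv (KP a P) = KP a (dP P) := fun P => funext fun z => (KP_deriv a ha P z).deriv
  rw [he, he]
  have h := KP_ibp a ha Polynomial.X z
  have i0 := kp_int a z ha Polynomial.X
  have i1 := kp_int a z ha (dP Polynomial.X)
  have i2 := kp_int a z ha (dP (dP Polynomial.X))
  unfold KP
  rw [← integral_const_mul, ← integral_const_mul, ← integral_add i2 (i1.const_mul _)]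
  have i3 := i2.add (i1.const_mul (z/2))
  refine (integral_add i3 (i0.const_mul (1 - a/2))).symm.trans ?_
  have h2 := congrArg (fun x => (-1/2 : ℝ) * x) h
  simp only [mul_zero] at h2
  rw [← integral_const_mul] at h2
  refine Eq.trans ?_ h2
  refine setIntegral_congr_fun measurableSet_Ioi fun t ht => ?_
  have ht' : (0:ℝ) < t := ht
  have hr : t ^ a = t ^ (a - 1) * t := by
    rw [Real.rpow_sub_one ht'.ne']
    field_simp
  simp only [hr, gP, dP, Pi.add_apply]
  simp
  ring
end

section
/- For every integer n ≥ 1, the function f_n is integrable on ℝ and ∫_{-∞}^{∞} f_n(z) dz = 0. -/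
open MeasureTheory Real Filter

lemma conv_aux (h k : ℝ → ℝ) (S : Set ℝ) (hh : Integrable h) (hk : IntegrableOn k S) :
    Integrable (fun z : ℝ => ∫ t in S, h (t + z) * k t) ∧
    (∫ z : ℝ, ∫ t in S, h (t + z) * k t) = (∫ z, h z) * ∫ t in S, k t := by
  have hh' : Integrable (fun x : ℝ => h (-x)) := hh.comp_neg
  have e : (fun z : ℝ => ∫ t in S, h (t + z) * k t) = fun z =>
      (convolution k (fun x : ℝ => h (-x)) (ContinuousLinearMap.mul ℝ ℝ)
        (volume.restrict S)) (-z) := by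
    funext z
    simp only [convolution, ContinuousLinearMap.mul_apply']
    refine integral_congr_ae (Eventually.of_forall fun t => ?_)
    simp only [show -(-z - t) = t + z by ring]
    ring
  constructor
  · rw [e]
    apply Integrable.comp_neg
    exact (Integrable.convolution_integrand (μ := volume) (ν := volume.restrict S)
      (ContinuousLinearMap.mul ℝ ℝ) hk hh').integral_prod_left
  · rw [e, integral_neg_eq_self (fun z => (convolution k (fun x : ℝ => h (-x))
        (ContinuousLinearMap.mul ℝ ℝ) (volume.restrict S)) z), integral_convolution _ hk hh']
    simp only [ContinuousLinearMap.mul_apply']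
    rw [integral_neg_eq_self h, mul_comm]

lemma G_int : Integrable (fun x : ℝ => Real.exp (-x^2/4)) := by
  have := integrable_exp_neg_mul_sq (b := 1/4) (by norm_num)
  refine this.congr (Eventually.of_forall fun x => ?_)
  simp only; congr 1; ring

lemma g_int : Integrable (fun x : ℝ => x * Real.exp (-x^2/4)) := by
  have := integrable_mul_exp_neg_mul_sq (b := 1/4) (by norm_num)
  refine this.congr (Eventually.of_forall fun x => ?_)
  simp only; congr 2; ring

lemma g_zero : ∫ x : ℝ, x * Real.exp (-x^2/4) = 0 := by
  have := integral_neg_eq_self (fun x : ℝ => x * Real.exp (-x^2/4)) volume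
  simp only [neg_mul, even_two, Even.neg_pow, integral_neg] at this
  linarith

lemma g_bdd (x : ℝ) : ‖x * Real.exp (-x^2/4)‖ ≤ 4 := by
  rw [norm_mul, Real.norm_eq_abs, Real.norm_eq_abs, abs_of_pos (Real.exp_pos _)]
  have h1 : x^2/4 + 1 ≤ Real.exp (x^2/4) := Real.add_one_le_exp _
  have h2 : Real.exp (-x^2/4) * Real.exp (x^2/4) = 1 := by
    rw [← Real.exp_add]; simp; ring
  have h3 : |x| ≤ 4 * (x^2/4 + 1) := by
    rw [← sq_abs]; nlinarith [sq_nonneg (|x| - 1)]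
  calc |x| * Real.exp (-x^2/4) ≤ (4 * Real.exp (x^2/4)) * Real.exp (-x^2/4) := by
        gcongr; linarith
    _ = 4 := by rw [mul_assoc, mul_comm (Real.exp _), h2]; ring

lemma int1 (b : ℝ) (hb : -1 < b) : IntegrableOn (fun t : ℝ => t ^ b) (Set.Ioc 0 1) := by
  have := intervalIntegral.intervalIntegrable_rpow' (a := 0) (b := 1) hb
  rwa [intervalIntegrable_iff, Set.uIoc_of_le zero_le_one] at this

lemma int_a (b z : ℝ) (hb : -1 < b) :
    IntegrableOn (fun t : ℝ => (t+z) * Real.exp (-(t+z)^2/4) * t ^ b) (Set.Ioc 0 1) := by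
  refine Integrable.bdd_mul (c := 4) (int1 b hb) ?_ (Eventually.of_forall fun x => g_bdd _)
  exact (by fun_prop : Continuous fun t : ℝ => (t+z) * Real.exp (-(t+z)^2/4)).aestronglyMeasurable

lemma int_bdd (b z : ℝ) (hb : b < 0) (F : ℝ → ℝ) (hF : Integrable F) :
    IntegrableOn (fun t : ℝ => F (t+z) * t ^ b) (Set.Ioi 1) := by
  refine Integrable.mul_bdd (c := 1) (hF.comp_add_right z).integrableOn ?_ ?_
  · exact (by fun_prop : Measurable fun t : ℝ => t ^ b).aestronglyMeasurable
  · filter_upwards [ae_restrict_mem measurableSet_Ioi] with t ht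
    have ht : (1:ℝ) < t := ht
    rw [Real.norm_eq_abs, abs_of_nonneg (by positivity)]
    exact Real.rpow_le_one_of_one_le_of_nonpos ht.le hb.le

lemma parts (b z : ℝ) (hb : b < 0) :
    ∫ t in Set.Ioi (1:ℝ), (t+z) * Real.exp (-(t+z)^2/4) * t ^ b =
      2 * Real.exp (-(1+z)^2/4) +
        2 * b * ∫ t in Set.Ioi (1:ℝ), Real.exp (-(t+z)^2/4) * t ^ (b-1) := by
  have i1 := int_bdd b z hb _ g_int
  have i2 := int_bdd (b-1) z (by linarith) _ G_int
  have hd : ∀ t ∈ Set.Ici (1:ℝ), HasDerivAt (fun t : ℝ => -2 * Real.exp (-(t+z)^2/4) * t ^ b)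
      ((t+z) * Real.exp (-(t+z)^2/4) * t ^ b - 2 * b * (Real.exp (-(t+z)^2/4) * t ^ (b-1))) t := by
    intro t ht
    have ht : (1:ℝ) ≤ t := ht
    have h1 : HasDerivAt (fun t : ℝ => -(t+z)^2/4) (-(2*(t+z))/4) t := by
      have := ((((hasDerivAt_id t).add_const z).pow 2).neg).div_const 4
      exact this.congr_deriv (by simp)
    have h2 := (h1.exp.const_mul (-2)).mul
      (Real.hasDerivAt_rpow_const (p := b) (x := t) (Or.inl (by linarith)))
    exact h2.congr_deriv (by ring)
  have hlim : Tendsto (fun t : ℝ => -2 * Real.exp (-(t+z)^2/4) * t ^ b) atTop (nhds 0) := by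
    have h0 : Tendsto (fun t : ℝ => t ^ b) atTop (nhds 0) := by
      simpa using tendsto_rpow_neg_atTop (y := -b) (by linarith)
    refine squeeze_zero_norm' (a := fun t : ℝ => 2 * t ^ b) ?_ (by simpa using h0.const_mul 2)
    filter_upwards [eventually_gt_atTop 0] with t ht
    have hp : 0 < t ^ b := by positivity
    rw [norm_mul, norm_mul, Real.norm_eq_abs, Real.norm_eq_abs, Real.norm_eq_abs,
      abs_of_pos (Real.exp_pos _), abs_of_pos hp]
    have : Real.exp (-(t+z)^2/4) ≤ 1 := Real.exp_le_one_iff.mpr (by nlinarith [sq_nonneg (t+z)])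
    norm_num
    nlinarith
  have key := integral_Ioi_of_hasDerivAt_of_tendsto' hd (i1.sub (i2.const_mul (2*b))) hlim
  rw [integral_sub i1 (i2.const_mul _), integral_const_mul] at key
  simp only [Real.one_rpow] at key
  linarith

lemma fn_eq_s3 (n : ℕ) (z : ℝ) : fn n z = ∫ t in Set.Ioi (0:ℝ),
    (t+z) * Real.exp (-(t+z)^2/4) * t ^ ((2:ℝ)^(-(n:ℝ)) - 1) := by
  have := (measurePreserving_add_right (volume : Measure ℝ) z).setIntegral_preimage_emb
    (measurableEmbedding_addRight z)
    (fun ξ => ξ * Real.exp (-ξ^2/4) * (ξ - z) ^ ((2:ℝ)^(-(n:ℝ)) - 1)) (Set.Ioi z)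
  rw [fn, ← this]
  simp

/-- For every integer `n ≥ 1`, `f_n` is integrable on `ℝ` and `∫ f_n = 0`. -/
theorem stmt_3 (n : ℕ) (hn : 1 ≤ n) :
    Integrable (fn n) ∧ (∫ z : ℝ, fn n z) = 0 := by
  set b : ℝ := (2:ℝ)^(-(n:ℝ)) - 1 with hbdef
  have hn' : (0:ℝ) < n := by exact_mod_cast hn
  have hb1 : -1 < b := by
    have : (0:ℝ) < (2:ℝ)^(-(n:ℝ)) := by positivity
    linarith
  have hb0 : b < 0 := by
    have : (2:ℝ)^(-(n:ℝ)) < 1 := Real.rpow_lt_one_of_one_lt_of_neg (by norm_num) (by linarith)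
    linarith
  have e : fn n = fun z => (∫ t in Set.Ioc (0:ℝ) 1, (t+z) * Real.exp (-(t+z)^2/4) * t ^ b) +
      (2 * Real.exp (-(z+1)^2/4) +
        2 * b * ∫ t in Set.Ioi (1:ℝ), Real.exp (-(t+z)^2/4) * t ^ (b-1)) := by
    funext z
    rw [fn_eq_s3, ← Set.Ioc_union_Ioi_eq_Ioi (zero_le_one (α := ℝ)),
      setIntegral_union (Set.Ioc_disjoint_Ioi le_rfl) measurableSet_Ioi (int_a b z hb1)
        (int_bdd b z hb0 _ g_int), parts b z hb0, add_comm z 1]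
  obtain ⟨A1, A2⟩ := conv_aux _ _ _ g_int (int1 b hb1)
  obtain ⟨B1, B2⟩ := conv_aux _ _ _ G_int
    (integrableOn_Ioi_rpow_of_lt (a := b-1) (by linarith) zero_lt_one)
  have C1 : Integrable (fun z : ℝ => Real.exp (-(z+1)^2/4)) := G_int.comp_add_right 1
  have C2 : ∫ z : ℝ, Real.exp (-(z+1)^2/4) = ∫ z : ℝ, Real.exp (-z^2/4) :=
    integral_add_right_eq_self (fun z : ℝ => Real.exp (-z^2/4)) 1
  have D1 := (C1.const_mul 2).add (B1.const_mul (2*b))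
  rw [e]
  refine ⟨A1.add D1, ?_⟩
  refine (integral_add A1 D1).trans ?_
  simp only [Pi.add_apply]
  rw [integral_add (C1.const_mul 2) (B1.const_mul (2*b)),
    integral_const_mul, integral_const_mul, A2, B2, C2, g_zero,
    integral_Ioi_rpow_of_lt (by linarith) zero_lt_one]
  simp only [sub_add_cancel, Real.one_rpow]
  have : b ≠ 0 := hb0.ne
  field_simp
  ring
end

section
/- For every integer n ≥ 1 there exists a constant C = C(n) > 0 such that for every m ∈ {0,1,2,3} and every z ∈ ℝ: if z ≥ 0 then |f_n^{(m)}(z)| ≤ C (1+z²)^{(1+m-2^{-n})/2} e^{-z²/4}, and if z ≤ 0 then |f_n^{(m)}(z)| ≤ C (1+z²)^{-(2+m-2^{-n})/2}. In particular f_n has Gaussian decay as z → +∞ and only algebraic decay of order |z|^{2^{-n}-2} as z → -∞. -/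
open MeasureTheory Real Filter

noncomputable def hP : ℕ → Polynomial ℝ
  | 0 => 1
  | (k+1) => Polynomial.derivative (hP k) - Polynomial.C (1/2) * Polynomial.X * hP k

lemma hP_succ (k : ℕ) : hP (k+1) =
    Polynomial.derivative (hP k) - Polynomial.C (1/2) * Polynomial.X * hP k := rfl

lemma hP_der (k : ℕ) : Polynomial.derivative (hP (k+1)) =
    - Polynomial.C (((k:ℝ)+1)/2) * hP k := by
  induction k with
  | zero =>
    simp [hP]
  | succ k ih =>
    rw [hP_succ (k+1), Polynomial.derivative_sub, ih]
    simp only [Polynomial.derivative_mul, Polynomial.derivative_neg, Polynomial.derivative_C,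
      Polynomial.derivative_X, ih]
    have e : Polynomial.C ((((k+1:ℕ):ℝ)+1)/2) = Polynomial.C (((k:ℝ)+1)/2) + Polynomial.C (1/2) := by
      rw [← Polynomial.C_add]; congr 1; push_cast; ring
    rw [e, hP_succ k]
    ring

lemma hP_rec (k : ℕ) (x : ℝ) : (hP (k+2)).eval x =
    - (x/2) * (hP (k+1)).eval x - ((k:ℝ)+1)/2 * (hP k).eval x := by
  rw [hP_succ (k+1), hP_der]
  simp
  ring

lemma hP_bound (k : ℕ) : ∃ K : ℝ, 0 < K ∧ ∀ x : ℝ, |(hP k).eval x| ≤ K * (1+|x|)^k := by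
  suffices h : (∃ K : ℝ, 0 < K ∧ ∀ x : ℝ, |(hP k).eval x| ≤ K * (1+|x|)^k) ∧
    (∃ K : ℝ, 0 < K ∧ ∀ x : ℝ, |(hP (k+1)).eval x| ≤ K * (1+|x|)^(k+1)) from h.1
  induction k with
  | zero =>
    refine ⟨⟨1, one_pos, fun x => by simp [hP]⟩, 1, one_pos, fun x => ?_⟩
    simp [hP, abs_mul]
    have := abs_nonneg x
    linarith
  | succ k ih =>
    refine ⟨ih.2, ?_⟩
    obtain ⟨⟨K, hK, h1⟩, L, hL, h2⟩ := ih
    refine ⟨L + ((k:ℝ)+1)/2 * K, by positivity, fun x => ?_⟩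
    rw [hP_rec]
    have hx := abs_nonneg x
    have a1 : |- (x/2) * (hP (k+1)).eval x| ≤ (1+|x|) * (L * (1+|x|)^(k+1)) := by
      rw [abs_mul]
      apply mul_le_mul _ (h2 x) (abs_nonneg _) (by positivity)
      rw [abs_neg, abs_div, abs_of_pos (by norm_num : (0:ℝ) < 2)]; linarith
    have a2 : |((k:ℝ)+1)/2 * (hP k).eval x| ≤ ((k:ℝ)+1)/2 * (K * (1+|x|)^(k+2)) := by
      rw [abs_mul, abs_of_nonneg (by positivity : (0:ℝ) ≤ ((k:ℝ)+1)/2)]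
      apply mul_le_mul_of_nonneg_left _ (by positivity)
      refine (h1 x).trans ?_
      gcongr
      · linarith
      · omega
    refine (abs_sub _ _).trans ?_
    calc _ ≤ (1+|x|) * (L * (1+|x|)^(k+1)) + ((k:ℝ)+1)/2 * (K * (1+|x|)^(k+2)) := add_le_add a1 a2
      _ = _ := by ring

noncomputable def hg (k : ℕ) (x : ℝ) : ℝ := (hP k).eval x * Real.exp (-x^2/4)

lemma hg_cont (k : ℕ) : Continuous (hg k) := by
  unfold hg; fun_prop

lemma hg_deriv (k : ℕ) (x : ℝ) : HasDerivAt (hg k) (hg (k+1) x) x := by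
  unfold hg
  have h1 := (hP k).hasDerivAt x
  have h2 : HasDerivAt (fun x : ℝ => Real.exp (-x^2/4)) (Real.exp (-x^2/4) * (-(x/2))) x := by
    apply HasDerivAt.exp
    have := ((hasDerivAt_pow 2 x).neg).div_const 4
    exact this.congr_deriv (by push_cast; ring)
  refine (h1.mul h2).congr_deriv ?_
  rw [hP_succ]; simp; ring

lemma hg_rec (k : ℕ) (x : ℝ) : x * hg (k+1) x = -2 * hg (k+2) x - ((k:ℝ)+1) * hg k x := by
  unfold hg; rw [hP_rec]; ring

lemma hg_bound (k : ℕ) : ∃ K : ℝ, 0 < K ∧ ∀ x : ℝ,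
    (1+|x|) * |hg k x| ≤ K * Real.exp (-(1/8) * x^2) := by
  obtain ⟨K, hK, h⟩ := hP_bound k
  refine ⟨K * ((k+1).factorial * Real.exp 3), by positivity, fun x => ?_⟩
  have hx := abs_nonneg x
  have h1 := Real.pow_div_factorial_le_exp (1+|x|) (by positivity) (k+1)
  rw [div_le_iff₀ (by positivity)] at h1
  have h2 : Real.exp (1+|x|) * Real.exp (-x^2/4) ≤ Real.exp 3 * Real.exp (-(1/8) * x^2) := by
    rw [← Real.exp_add, ← Real.exp_add]
    apply Real.exp_le_exp.2
    nlinarith [sq_nonneg (|x| - 4), sq_abs x]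
  unfold hg
  rw [abs_mul, abs_of_pos (Real.exp_pos _)]
  calc _ ≤ (1+|x|) * (K * (1+|x|)^k * Real.exp (-x^2/4)) := by gcongr; exact h x
    _ = K * ((1+|x|)^(k+1) * Real.exp (-x^2/4)) := by ring
    _ ≤ K * ((Real.exp (1+|x|) * (k+1).factorial) * Real.exp (-x^2/4)) := by gcongr
    _ = K * ((k+1).factorial * (Real.exp (1+|x|) * Real.exp (-x^2/4))) := by ring
    _ ≤ K * ((k+1).factorial * (Real.exp 3 * Real.exp (-(1/8) * x^2))) := by gcongr
    _ = _ := by ring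

lemma hg_bound1 (k : ℕ) : ∃ K : ℝ, 0 < K ∧ ∀ x s : ℝ,
    |hg k (x+s)| ≤ K * Real.exp |x| * Real.exp (-s) := by
  obtain ⟨K, hK, h⟩ := hg_bound k
  refine ⟨K * Real.exp 2, by positivity, fun x s => ?_⟩
  have h0 : |hg k (x+s)| ≤ (1+|x+s|) * |hg k (x+s)| := by
    nlinarith [abs_nonneg (x+s), abs_nonneg (hg k (x+s)),
      mul_nonneg (abs_nonneg (x+s)) (abs_nonneg (hg k (x+s)))]
  refine (h0.trans (h _)).trans ?_
  rw [mul_assoc, mul_assoc, ← Real.exp_add, ← Real.exp_add]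
  gcongr
  nlinarith [sq_nonneg ((x+s) - 4), neg_le_abs x]

noncomputable def hH (a : ℝ) (k : ℕ) (z : ℝ) : ℝ :=
  ∫ s in Set.Ioi (0:ℝ), hg k (z+s) * s ^ (a-1)

lemma hmeas (a : ℝ) (k : ℕ) (z : ℝ) :
    AEStronglyMeasurable (fun s : ℝ => hg k (z+s) * s ^ (a-1)) (volume.restrict (Set.Ioi (0:ℝ))) := by
  apply Measurable.aestronglyMeasurable
  have := (hg_cont k).measurable
  fun_prop

lemma hint (a : ℝ) (ha : 0 < a) (k : ℕ) (z : ℝ) :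
    IntegrableOn (fun s : ℝ => hg k (z+s) * s ^ (a-1)) (Set.Ioi (0:ℝ)) := by
  obtain ⟨K, hK, h⟩ := hg_bound1 k
  refine Integrable.mono' ((Real.GammaIntegral_convergent ha).const_mul (K * Real.exp |z|))
    (hmeas a k z) ?_
  filter_upwards [ae_restrict_mem measurableSet_Ioi] with s hs
  have hs : 0 < s := hs
  rw [Real.norm_eq_abs, abs_mul, abs_of_pos (Real.rpow_pos_of_pos hs _), ← mul_assoc]
  gcongr
  exact h z s

lemma hH_deriv (a : ℝ) (ha : 0 < a) (k : ℕ) (z : ℝ) :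
    HasDerivAt (hH a k) (hH a (k+1) z) z := by
  obtain ⟨K, hK, h⟩ := hg_bound1 (k+1)
  refine (hasDerivAt_integral_of_dominated_loc_of_deriv_le
    (F := fun z s => hg k (z+s) * s ^ (a-1)) (F' := fun z s => hg (k+1) (z+s) * s ^ (a-1))
    (bound := fun s => (K * Real.exp (|z|+1)) * (Real.exp (-s) * s^(a-1)))
    (Metric.ball_mem_nhds z one_pos) (Filter.Eventually.of_forall fun x => hmeas a k x)
    (hint a ha k z) (hmeas a (k+1) z) ?_
    ((Real.GammaIntegral_convergent ha).const_mul _) ?_).2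
  · filter_upwards [ae_restrict_mem measurableSet_Ioi] with s hs x hx
    have hs : 0 < s := hs
    rw [Real.norm_eq_abs, abs_mul, abs_of_pos (Real.rpow_pos_of_pos hs _), ← mul_assoc]
    gcongr
    refine (h x s).trans ?_
    gcongr
    rw [Metric.mem_ball, Real.dist_eq] at hx
    have := abs_sub_abs_le_abs_sub x z
    linarith
  · filter_upwards with s x hx
    exact ((hg_deriv k (x+s)).comp_add_const x s).mul_const _

lemma hH_rec (a : ℝ) (ha : 0 < a) (k : ℕ) (z : ℝ) :
    z * hH a (k+1) z = -2 * hH a (k+2) z - ((k:ℝ)+1-a) * hH a k z := by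
  have key := integral_Ioi_of_hasDerivAt_of_tendsto (a := 0) (m := 0)
    (f := fun s : ℝ => hg k (z+s) * s^a)
    (f' := fun s : ℝ => -2 * (hg (k+2) (z+s) * s^(a-1)) - ((k:ℝ)+1-a) * (hg k (z+s) * s^(a-1))
      - z * (hg (k+1) (z+s) * s^(a-1))) ?_ ?_ ?_ ?_
  · have i0 := hint a ha k z
    have i1 := hint a ha (k+1) z
    have i2 := hint a ha (k+2) z
    have i20 : IntegrableOn (fun s : ℝ => -2 * (hg (k+2) (z+s) * s^(a-1))
        - ((k:ℝ)+1-a) * (hg k (z+s) * s^(a-1))) (Set.Ioi 0) :=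
      (i2.const_mul _).sub (i0.const_mul _)
    rw [integral_sub i20 (i1.const_mul _),
      integral_sub (i2.const_mul _) (i0.const_mul _), integral_const_mul, integral_const_mul,
      integral_const_mul, Real.zero_rpow ha.ne'] at key
    unfold hH
    linarith
  · apply Continuous.continuousWithinAt
    have := hg_cont k
    exact (this.comp (continuous_const.add continuous_id)).mul
      (Real.continuous_rpow_const ha.le)
  · intro s hs
    have hs : 0 < s := hs
    have h1 := ((hg_deriv k (z+s)).comp_const_add z s).mul
      (Real.hasDerivAt_rpow_const (p := a) (Or.inl hs.ne'))
    refine h1.congr_deriv ?_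
    have e : s^a = s * s^(a-1) := by
      rw [Real.rpow_sub_one hs.ne']; field_simp
    have := hg_rec k (z+s)
    rw [e]
    linear_combination (s^(a-1)) * this
  · exact (((hint a ha (k+2) z).const_mul _).sub ((hint a ha k z).const_mul _)).sub
      ((hint a ha (k+1) z).const_mul _)
  · obtain ⟨K, hK, h⟩ := hg_bound1 k
    have t := (tendsto_rpow_mul_exp_neg_mul_atTop_nhds_zero a 1 one_pos).const_mul (K * Real.exp |z|)
    rw [mul_zero] at t
    refine squeeze_zero_norm' ?_ t
    filter_upwards [Filter.eventually_gt_atTop 0] with s hs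
    rw [Real.norm_eq_abs, abs_mul, abs_of_pos (Real.rpow_pos_of_pos hs _)]
    have := h z s
    have hp := Real.rpow_pos_of_pos hs a
    calc _ ≤ (K * Real.exp |z| * Real.exp (-s)) * s^a := by gcongr
      _ = _ := by rw [neg_one_mul]; ring

lemma hH_pos (a : ℝ) (ha : 0 < a) (k : ℕ) (hak : a ≤ k) : ∃ C : ℝ, 0 < C ∧ ∀ z : ℝ, 0 ≤ z →
    |hH a k z| ≤ C * (1+z^2)^(((k:ℝ)-a)/2) * Real.exp (-z^2/4) := by
  obtain ⟨K, hK, h⟩ := hP_bound k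
  set M : ℝ := K * (k.factorial * Real.exp 4) with hM
  have hM0 : 0 < M := by positivity
  have hG := Real.Gamma_pos_of_pos ha
  refine ⟨M * (2^a * Real.Gamma a) * 2^(((k:ℝ)-a)/2), by positivity, fun z hz => ?_⟩
  have hr : 0 < (1+z)/2 := by positivity
  have hI := Real.integral_rpow_mul_exp_neg_mul_Ioi ha hr
  have hIi : IntegrableOn (fun t : ℝ => t ^ (a - 1) * Real.exp (-((1+z)/2 * t))) (Set.Ioi 0) := by
    by_contra hc
    rw [integral_undef hc] at hI
    have : 0 < (1 / ((1+z)/2)) ^ a * Real.Gamma a := by positivity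
    linarith
  have b1 : |hH a k z| ≤ ∫ s in Set.Ioi (0:ℝ), (M * (1+z)^k * Real.exp (-z^2/4)) *
      (s ^ (a - 1) * Real.exp (-((1+z)/2 * s))) := by
    unfold hH
    rw [← Real.norm_eq_abs]
    refine norm_integral_le_of_norm_le (hIi.const_mul _) ?_
    filter_upwards [ae_restrict_mem measurableSet_Ioi] with s hs
    have hs : 0 < s := hs
    have hp := Real.rpow_pos_of_pos hs (a-1)
    rw [Real.norm_eq_abs, abs_mul, abs_of_pos hp]
    have c1 : |hg k (z+s)| ≤ K * ((1+z)^k * (1+s)^k) * Real.exp (-(z+s)^2/4) := by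
      unfold hg
      rw [abs_mul, abs_of_pos (Real.exp_pos _)]
      gcongr
      refine (h _).trans ?_
      rw [abs_of_nonneg (by positivity), ← mul_pow]
      gcongr
      nlinarith [mul_nonneg hz hs.le]
    have c2 := Real.pow_div_factorial_le_exp (1+s) (by positivity) k
    rw [div_le_iff₀ (by positivity)] at c2
    have c3 : Real.exp (1+s) * Real.exp (-(z+s)^2/4) ≤
        Real.exp 4 * Real.exp (-z^2/4) * Real.exp (-((1+z)/2 * s)) := by
      rw [← Real.exp_add, ← Real.exp_add, ← Real.exp_add]
      apply Real.exp_le_exp.2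
      nlinarith [sq_nonneg (s-3)]
    calc _ ≤ (K * ((1+z)^k * (1+s)^k) * Real.exp (-(z+s)^2/4)) * s^(a-1) := by gcongr
      _ ≤ (K * ((1+z)^k * (Real.exp (1+s) * k.factorial)) * Real.exp (-(z+s)^2/4)) * s^(a-1) := by
          gcongr
      _ = (K * (1+z)^k * k.factorial) * (Real.exp (1+s) * Real.exp (-(z+s)^2/4)) * s^(a-1) := by ring
      _ ≤ (K * (1+z)^k * k.factorial) *
          (Real.exp 4 * Real.exp (-z^2/4) * Real.exp (-((1+z)/2 * s))) * s^(a-1) := by gcongr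
      _ = _ := by rw [hM]; ring
  rw [integral_const_mul, hI] at b1
  refine b1.trans (le_of_eq_of_le
    (b := M * (2^a * Real.Gamma a) * (1+z)^((k:ℝ)-a) * Real.exp (-z^2/4)) ?_ ?_)
  · rw [one_div_div, Real.div_rpow (by norm_num) (by positivity), Real.rpow_sub (by positivity),
      Real.rpow_natCast]
    ring
  · have : (1+z)^((k:ℝ)-a) ≤ 2^(((k:ℝ)-a)/2) * (1+z^2)^(((k:ℝ)-a)/2) := by
      rw [← Real.mul_rpow (by norm_num) (by positivity)]
      have : (1+z)^((k:ℝ)-a) = ((1+z)^2)^(((k:ℝ)-a)/2) := by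
        rw [← Real.rpow_natCast, ← Real.rpow_mul (by positivity)]; congr 1; push_cast; ring
      rw [this]
      apply Real.rpow_le_rpow (by positivity) _ (by linarith)
      nlinarith [sq_nonneg (z-1)]
    calc _ ≤ M * (2^a * Real.Gamma a) * (2^(((k:ℝ)-a)/2) * (1+z^2)^(((k:ℝ)-a)/2)) * Real.exp (-z^2/4) := by
          gcongr
      _ = _ := by ring

lemma hH_crude (a : ℝ) (ha : 0 < a) (ha1 : a ≤ 1) (k : ℕ) : ∃ C : ℝ, 0 < C ∧ ∀ z : ℝ,
    |hH a k z| ≤ C * (1+|z|)^(a-1) := by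
  obtain ⟨K, hK, h⟩ := hg_bound k
  have hG := Real.Gamma_pos_of_pos ha
  have hE : Integrable (fun x : ℝ => Real.exp (-(1/8) * x^2)) :=
    integrable_exp_neg_mul_sq (by norm_num)
  have hE0 : 0 ≤ ∫ x : ℝ, Real.exp (-(1/8) * x^2) := integral_nonneg fun x => (Real.exp_pos _).le
  have hGi := Real.GammaIntegral_convergent ha
  refine ⟨2 * K * (∫ x : ℝ, Real.exp (-(1/8) * x^2)) + K * Real.exp 1 * Real.Gamma a,
    by positivity, fun z => ?_⟩
  have hz := abs_nonneg z
  have hw : 0 < (1+|z|)^(1-a) := by positivity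
  have hEz : Integrable (fun s : ℝ => Real.exp (-(1/8) * (z+s)^2)) := hE.comp_add_left z
  have b1 : |hH a k z * (1+|z|)^(1-a)| ≤ ∫ s in Set.Ioi (0:ℝ),
      (2 * K * Real.exp (-(1/8) * (z+s)^2) + K * Real.exp 1 * (Real.exp (-s) * s^(a-1))) := by
    unfold hH
    rw [← Real.norm_eq_abs, ← integral_mul_const]
    refine norm_integral_le_of_norm_le ((hEz.integrableOn.const_mul _).add (hGi.const_mul _)) ?_
    filter_upwards [ae_restrict_mem measurableSet_Ioi] with s hs
    have hs : 0 < s := hs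
    have hp := Real.rpow_pos_of_pos hs (a-1)
    rw [Real.norm_eq_abs, abs_mul, abs_mul, abs_of_pos hp, abs_of_pos hw]
    have hx := abs_nonneg (z+s)
    have c1 : (1+|z|)^(1-a) ≤ (1+|z+s|) * (1 + s^(1-a)) := by
      have : (1+|z|) ≤ (1+|z+s|)*(1+s) := by
        have : |z| ≤ |z+s| + s := by
          have := abs_sub (z+s) s
          rw [add_sub_cancel_right, abs_of_pos hs] at this; exact this
        nlinarith
      calc _ ≤ ((1+|z+s|)*(1+s))^(1-a) := Real.rpow_le_rpow (by positivity) this (by linarith)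
        _ = (1+|z+s|)^(1-a) * (1+s)^(1-a) := Real.mul_rpow (by positivity) (by positivity)
        _ ≤ _ := by
          gcongr
          · calc _ ≤ (1+|z+s|)^(1:ℝ) := Real.rpow_le_rpow_of_exponent_le (by linarith) (by linarith)
              _ = _ := Real.rpow_one _
          · have := Real.rpow_add_le_add_rpow (zero_le_one) hs.le (by linarith : 0 ≤ 1-a) (by linarith)
            rwa [Real.one_rpow] at this
    have c2 : s^(1-a) * s^(a-1) = 1 := by
      rw [← Real.rpow_add hs]; simp
    have c3 : s^(a-1) ≤ 1 + Real.exp 1 * (Real.exp (-s) * s^(a-1)) := by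
      rcases le_total s 1 with h1 | h1
      · have : 1 ≤ Real.exp 1 * Real.exp (-s) := by
          rw [← Real.exp_add]; apply Real.one_le_exp; linarith
        nlinarith
      · have := Real.rpow_le_one_of_one_le_of_nonpos h1 (by linarith : a-1 ≤ 0)
        have : 0 ≤ Real.exp 1 * (Real.exp (-s) * s^(a-1)) := by positivity
        linarith
    have c4 : Real.exp (-(1/8) * (z+s)^2) ≤ 1 := Real.exp_le_one_iff.2 (by nlinarith [sq_nonneg (z+s)])
    have hq : 0 ≤ Real.exp 1 * (Real.exp (-s) * s^(a-1)) := by positivity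
    calc _ ≤ |hg k (z+s)| * s^(a-1) * ((1+|z+s|) * (1 + s^(1-a))) := by gcongr
      _ = ((1+|z+s|) * |hg k (z+s)|) * (s^(a-1) + s^(1-a) * s^(a-1)) := by ring
      _ ≤ (K * Real.exp (-(1/8) * (z+s)^2)) * (2 + Real.exp 1 * (Real.exp (-s) * s^(a-1))) := by
        apply mul_le_mul (h _) _ (by rw [c2]; positivity) (by positivity)
        rw [c2]; linarith
      _ = 2 * K * Real.exp (-(1/8) * (z+s)^2) +
          K * (Real.exp (-(1/8) * (z+s)^2) * (Real.exp 1 * (Real.exp (-s) * s^(a-1)))) := by ring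
      _ ≤ 2 * K * Real.exp (-(1/8) * (z+s)^2) +
          K * (1 * (Real.exp 1 * (Real.exp (-s) * s^(a-1)))) := by gcongr
      _ = _ := by ring
  rw [integral_add (hEz.integrableOn.const_mul _) (hGi.const_mul _), integral_const_mul,
    integral_const_mul, ← Real.Gamma_eq_integral ha, abs_mul, abs_of_pos hw] at b1
  have b2 : ∫ s in Set.Ioi (0:ℝ), Real.exp (-(1/8) * (z+s)^2) ≤ ∫ x : ℝ, Real.exp (-(1/8) * x^2) := by
    rw [← integral_add_left_eq_self (fun x : ℝ => Real.exp (-(1/8) * x^2)) z]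
    exact setIntegral_le_integral hEz (Filter.Eventually.of_forall fun x => (Real.exp_pos _).le)
  have e : (1+|z|)^(a-1) = ((1+|z|)^(1-a))⁻¹ := by
    rw [← Real.rpow_neg (by positivity)]; congr 1; ring
  rw [e, ← div_eq_mul_inv, le_div_iff₀ hw]
  refine b1.trans ?_
  gcongr

lemma hH_neg (a : ℝ) (ha : 0 < a) (ha1 : a ≤ 1) (j : ℕ) : ∀ k, j ≤ k → ∃ C : ℝ, 0 < C ∧ ∀ z : ℝ,
    z ≤ 0 → |hH a k z| ≤ C * (1+|z|)^(a-1-j) := by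
  induction j with
  | zero =>
    intro k _
    obtain ⟨C, hC, h⟩ := hH_crude a ha ha1 k
    exact ⟨C, hC, fun z _ => by simpa using h z⟩
  | succ j ih =>
    intro k hk
    obtain ⟨k, rfl⟩ : ∃ l, k = l + 1 := ⟨k-1, by omega⟩
    obtain ⟨C0, hC0, h0⟩ := ih k (by omega)
    obtain ⟨C1, hC1, h1⟩ := ih (k+1) (by omega)
    obtain ⟨C2, hC2, h2⟩ := ih (k+2) (by omega)
    have hc : 0 ≤ (k:ℝ)+1-a := by have : (0:ℝ) ≤ k := k.cast_nonneg; linarith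
    refine ⟨C1 + 2*C2 + ((k:ℝ)+1-a)*C0, by positivity, fun z hz => ?_⟩
    have hzz := abs_nonneg z
    have e : (1+|z|)^(a-1-((j+1:ℕ):ℝ)) = (1+|z|)^(a-1-j) / (1+|z|) := by
      rw [← Real.rpow_sub_one (by positivity)]; congr 1; push_cast; ring
    rw [e, mul_div_assoc', le_div_iff₀ (by positivity)]
    have r := hH_rec a ha k z
    have r2 : |z| * |hH a (k+1) z| ≤ 2 * |hH a (k+2) z| + ((k:ℝ)+1-a) * |hH a k z| := by
      rw [← abs_mul, r]
      refine (abs_sub _ _).trans ?_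
      rw [abs_mul, abs_mul, abs_of_nonneg hc]
      norm_num
    have := mul_le_mul_of_nonneg_left (h0 z hz) hc
    nlinarith [h1 z hz, h2 z hz]

lemma fn_eq_s4 (n : ℕ) : fn n = fun z => -2 * hH ((2:ℝ)^(-(n:ℝ))) 1 z := by
  funext z
  unfold fn hH
  rw [← integral_const_mul]
  have h := (measurePreserving_add_left (volume : Measure ℝ) z).setIntegral_preimage_emb
    (measurableEmbedding_addLeft z)
    (fun ξ => ξ * Real.exp (-ξ^2/4) * (ξ - z) ^ ((2:ℝ)^(-(n:ℝ)) - 1)) (Set.Ioi z)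
  rw [← h]
  have : (fun x => z + x) ⁻¹' Set.Ioi z = Set.Ioi 0 := by ext; simp
  rw [this]
  congr 1
  funext s
  simp [hg, hP]
  ring

lemma fn_iter (n m : ℕ) : iteratedDeriv m (fn n) =
    fun z => -2 * hH ((2:ℝ)^(-(n:ℝ))) (m+1) z := by
  induction m with
  | zero => rw [iteratedDeriv_zero, fn_eq_s4]
  | succ m ih =>
    rw [iteratedDeriv_succ, ih]
    funext z
    exact ((hH_deriv _ (by positivity) (m+1) z).const_mul (-2)).deriv

lemma bound_each (n m : ℕ) :
    ∃ C : ℝ, 0 < C ∧ ∀ z : ℝ,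
      (0 ≤ z → |iteratedDeriv m (fn n) z| ≤
        C * (1 + z^2) ^ ((1 + (m:ℝ) - (2:ℝ)^(-(n:ℝ))) / 2) * Real.exp (-z^2/4)) ∧
      (z ≤ 0 → |iteratedDeriv m (fn n) z| ≤
        C * (1 + z^2) ^ (-((2 + (m:ℝ) - (2:ℝ)^(-(n:ℝ))) / 2))) := by
  rw [fn_iter]
  have ha : 0 < (2:ℝ)^(-(n:ℝ)) := by positivity
  have ha1 : (2:ℝ)^(-(n:ℝ)) ≤ 1 :=
    Real.rpow_le_one_of_one_le_of_nonpos (by norm_num) (by simp)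
  generalize (2:ℝ)^(-(n:ℝ)) = a at *
  have hm : (0:ℝ) ≤ m := m.cast_nonneg
  obtain ⟨C1, hC1, h1⟩ := hH_pos a ha (m+1) (by push_cast; linarith)
  obtain ⟨C2, hC2, h2⟩ := hH_neg a ha ha1 (m+1) (m+1) le_rfl
  refine ⟨2*(C1+C2), by positivity, fun z => ⟨fun hz => ?_, fun hz => ?_⟩⟩
  · have := h1 z hz
    rw [abs_mul]
    norm_num
    push_cast at this
    rw [add_comm (m:ℝ) 1] at this
    have q : 0 ≤ (1+z^2)^((1+(m:ℝ)-a)/2) * Real.exp (-z^2/4) := by positivity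
    nlinarith
  · have := h2 z hz
    rw [abs_mul]
    norm_num
    have q : (1+|z|)^(a-1-((m+1:ℕ):ℝ)) ≤ (1+z^2)^(-((2+(m:ℝ)-a)/2)) := by
      have e : (1+|z|)^(a-1-((m+1:ℕ):ℝ)) = ((1+|z|)^2)^(-((2+(m:ℝ)-a)/2)) := by
        rw [← Real.rpow_natCast, ← Real.rpow_mul (by positivity)]; congr 1; push_cast; ring
      rw [e]
      apply Real.rpow_le_rpow_of_nonpos (by positivity) _ (by linarith)
      nlinarith [abs_nonneg z, sq_abs z]
    have q2 : 0 ≤ (1+z^2)^(-((2+(m:ℝ)-a)/2)) := by positivity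
    nlinarith

/-- For every integer `n ≥ 1` there is `C = C(n) > 0` such that for every
`m ∈ {0,1,2,3}` and every `z ∈ ℝ`: if `z ≥ 0` then
`|f_n^{(m)}(z)| ≤ C (1+z²)^{(1+m-2^{-n})/2} e^{-z²/4}`, and if `z ≤ 0` then
`|f_n^{(m)}(z)| ≤ C (1+z²)^{-(2+m-2^{-n})/2}`. -/
theorem stmt_4 (n : ℕ) (hn : 1 ≤ n) :
    ∃ C : ℝ, 0 < C ∧ ∀ m : ℕ, m ≤ 3 → ∀ z : ℝ,
      (0 ≤ z → |iteratedDeriv m (fn n) z| ≤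
        C * (1 + z^2) ^ ((1 + (m:ℝ) - (2:ℝ)^(-(n:ℝ))) / 2) * Real.exp (-z^2/4)) ∧
      (z ≤ 0 → |iteratedDeriv m (fn n) z| ≤
        C * (1 + z^2) ^ (-((2 + (m:ℝ) - (2:ℝ)^(-(n:ℝ))) / 2))) := by
  choose C hC h using bound_each n
  have hsum : ∀ m ≤ 3, C m ≤ C 0 + C 1 + C 2 + C 3 := by
    intro m hm
    have := hC 0
    have := hC 1
    have := hC 2
    have := hC 3
    interval_cases m <;> linarith
  refine ⟨C 0 + C 1 + C 2 + C 3, by linarith [hC 0, hC 1, hC 2, hC 3], fun m hm z =>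
    ⟨fun hz => ((h m z).1 hz).trans ?_, fun hz => ((h m z).2 hz).trans ?_⟩⟩
  · gcongr
    exact hsum m hm
  · gcongr
    exact hsum m hm
end

section
/- Fix an integer n ≥ 1. If g : ℝ → ℝ is twice continuously differentiable, satisfies g''(z) + (z/2) g'(z) + (1 - 2^{-(n+1)}) g(z) = 0 for all z ∈ ℝ, satisfies g(0) = 2^{2^{-n}} Γ((1 + 2^{-n})/2), and satisfies limsup_{z→+∞} z^{2^{-n}-1} e^{z²/4} |g(z)| < ∞, then g = f_n. -/
open MeasureTheory Real Filter

namespace S6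

def Bd (k : ℝ → ℝ) (K : ℝ) : Prop := ∀ x, |k x| ≤ K * Real.exp (-x^2/5)

noncomputable def F (k : ℝ → ℝ) (s z : ℝ) : ℝ := ∫ t in Set.Ioi (0:ℝ), k (t + z) * t ^ s

lemma bd_of_poly (p : ℝ → ℝ) (hp : ∀ x, |p x| ≤ 2 * (1 + x^4)) :
    Bd (fun x => p x * Real.exp (-x^2/4)) 1600 := by
  intro x
  have h1 := Real.quadratic_le_exp_of_nonneg (x := x^2/20) (by positivity)
  have h2 : Real.exp (-x^2/5) = Real.exp (x^2/20) * Real.exp (-x^2/4) := by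
    rw [← Real.exp_add]; congr 1; ring
  rw [abs_mul, abs_of_pos (Real.exp_pos _), h2, ← mul_assoc]
  refine mul_le_mul_of_nonneg_right ((hp x).trans ?_) (Real.exp_pos _).le
  nlinarith [sq_nonneg x, sq_nonneg (x^2)]

lemma Bd.nonneg {k : ℝ → ℝ} {K : ℝ} (h : Bd k K) : 0 ≤ K := by
  have := (abs_nonneg _).trans (h 0)
  simpa using this

lemma Bd.shift {k : ℝ → ℝ} {K : ℝ} (h : Bd k K) (t z : ℝ) :
    |k (t + z)| ≤ K * Real.exp (z^2/5) * Real.exp (-(1/10) * t^2) := by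
  refine (h _).trans ?_
  rw [mul_assoc, ← Real.exp_add]
  refine mul_le_mul_of_nonneg_left (Real.exp_le_exp.2 ?_) h.nonneg
  nlinarith [sq_nonneg (t + 2 * z)]

lemma meas {k : ℝ → ℝ} (hk : Continuous k) (s z : ℝ) :
    AEStronglyMeasurable (fun t => k (t + z) * t ^ s) (volume.restrict (Set.Ioi (0:ℝ))) := by
  apply Measurable.aestronglyMeasurable
  have := hk.measurable
  fun_prop

lemma integ {k : ℝ → ℝ} {K : ℝ} (hk : Continuous k) (h : Bd k K) {s : ℝ} (hs : -1 < s) (z : ℝ) :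
    IntegrableOn (fun t => k (t + z) * t ^ s) (Set.Ioi 0) := by
  have hb := (integrableOn_rpow_mul_exp_neg_mul_sq (b := 1/10) (by norm_num) hs).const_mul
    (K * Real.exp (z^2/5))
  refine Integrable.mono' hb (meas hk s z) ?_
  filter_upwards [ae_restrict_mem measurableSet_Ioi] with t ht
  have ht : 0 < t := ht
  have h2 : 0 ≤ t ^ s := by positivity
  rw [Real.norm_eq_abs, abs_mul, abs_of_nonneg h2]
  calc _ ≤ _ := mul_le_mul_of_nonneg_right (h.shift t z) h2
    _ = _ := by ring

lemma F_deriv {k k' : ℝ → ℝ} {K K' : ℝ} (hk : Continuous k) (h : Bd k K)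
    (hk' : Continuous k') (h' : Bd k' K') (hd : ∀ x, HasDerivAt k (k' x) x)
    {s : ℝ} (hs : -1 < s) (z : ℝ) : HasDerivAt (F k s) (F k' s z) z := by
  have hb := (integrableOn_rpow_mul_exp_neg_mul_sq (b := 1/10) (by norm_num) hs).const_mul
    (K' * Real.exp ((|z|+1)^2/5))
  refine (hasDerivAt_integral_of_dominated_loc_of_deriv_le (s := Metric.ball z 1)
    (F := fun z t => k (t + z) * t ^ s) (F' := fun z t => k' (t + z) * t ^ s)
    (Metric.ball_mem_nhds z one_pos) (Eventually.of_forall fun x => meas hk s x)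
    (integ hk h hs z) (meas hk' s z) ?_ hb ?_).2
  · filter_upwards [ae_restrict_mem measurableSet_Ioi] with t ht x hx
    have ht : 0 < t := ht
    have h2 : 0 ≤ t ^ s := by positivity
    have hx1 : |x| ≤ |z| + 1 := by
      rw [Metric.mem_ball, Real.dist_eq] at hx
      have := abs_sub_abs_le_abs_sub x z
      linarith
    have hx2 : x^2 ≤ (|z|+1)^2 := by
      rw [← sq_abs x]; gcongr
    rw [Real.norm_eq_abs, abs_mul, abs_of_nonneg h2]
    have hK := h'.nonneg
    calc _ ≤ _ := mul_le_mul_of_nonneg_right (h'.shift t x) h2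
      _ ≤ K' * Real.exp ((|z|+1)^2/5) * Real.exp (-(1/10) * t^2) * t ^ s := by gcongr
      _ = _ := by ring
  · filter_upwards with t x hx
    have h1 : HasDerivAt (fun x => k (t + x)) (k' (t + x)) x := by
      simpa using (hd (t + x)).comp_const_add t x
    exact h1.mul_const _

lemma F_parts {k k' : ℝ → ℝ} {K K' : ℝ} (hk : Continuous k) (h : Bd k K)
    (hk' : Continuous k') (h' : Bd k' K') (hd : ∀ x, HasDerivAt k (k' x) x)
    {a : ℝ} (ha : 0 < a) (z : ℝ) : F k' a z = - a * F k (a - 1) z := by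
  have i1 := integ hk' h' (s := a) (by linarith) z
  have i2 := integ hk h (s := a - 1) (by linarith) z
  have i3 := integ hk h (s := a) (by linarith) z
  have i4 : IntegrableOn (fun t => k' (t + z) * t ^ a + a * (k (t + z) * t ^ (a - 1)))
      (Set.Ioi 0) := i1.add (i2.const_mul a)
  have hder : ∀ t ∈ Set.Ioi (0:ℝ), HasDerivAt (fun t => k (t + z) * t ^ a)
      (k' (t + z) * t ^ a + a * (k (t + z) * t ^ (a - 1))) t := by
    intro t ht
    have ht : 0 < t := ht
    have h1 : HasDerivAt (fun t => k (t + z)) (k' (t + z)) t := by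
      simpa using (hd (t + z)).comp_add_const t z
    exact (h1.mul (Real.hasDerivAt_rpow_const (p := a) (Or.inl ht.ne'))).congr_deriv (by ring)
  have hc : Continuous (fun t => k (t + z) * t ^ a) :=
    (hk.comp (by fun_prop)).mul (Real.continuous_rpow_const ha.le)
  have := integral_Ioi_of_hasDerivAt_of_tendsto (a := 0) hc.continuousWithinAt hder i4
    (tendsto_zero_of_hasDerivAt_of_integrableOn_Ioi hder i4 i3)
  rw [integral_add i1 (i2.const_mul a), integral_const_mul] at this
  simp only [Real.zero_rpow ha.ne', mul_zero, sub_zero] at this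
  unfold F
  linarith

lemma F_bound {k : ℝ → ℝ} {K : ℝ} (h : Bd k K) {s : ℝ} (hs : -1 < s) :
    ∃ C, 0 ≤ C ∧ ∀ z, 0 ≤ z → |F k s z| ≤ C * Real.exp (-z^2/5) := by
  have hb := integrableOn_rpow_mul_exp_neg_mul_sq (b := 1/5) (by norm_num) hs
  have hK := h.nonneg
  refine ⟨K * ∫ t in Set.Ioi (0:ℝ), t ^ s * Real.exp (-(1/5) * t^2), ?_, ?_⟩
  · refine mul_nonneg hK (setIntegral_nonneg measurableSet_Ioi fun t ht => ?_)
    have ht : 0 < t := ht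
    positivity
  intro z hz
  rw [mul_assoc, mul_comm (∫ t in _, _), ← mul_assoc, ← integral_const_mul]
  unfold F
  rw [← Real.norm_eq_abs]
  refine norm_integral_le_of_norm_le (hb.const_mul _) ?_
  filter_upwards [ae_restrict_mem measurableSet_Ioi] with t ht
  have ht : 0 < t := ht
  have h2 : 0 ≤ t ^ s := by positivity
  rw [Real.norm_eq_abs, abs_mul, abs_of_nonneg h2]
  have h3 : Real.exp (-(t+z)^2/5) ≤ Real.exp (-z^2/5) * Real.exp (-(1/5) * t^2) := by
    rw [← Real.exp_add]
    apply Real.exp_le_exp.2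
    nlinarith [mul_nonneg ht.le hz]
  calc _ ≤ _ := mul_le_mul_of_nonneg_right (h _) h2
    _ ≤ K * (Real.exp (-z^2/5) * Real.exp (-(1/5) * t^2)) * t ^ s := by gcongr
    _ = _ := by ring

lemma ode_unique (c : ℝ) (w w' : ℝ → ℝ) (h1 : ∀ z, HasDerivAt w (w' z) z)
    (h2 : ∀ z, HasDerivAt w' (-(z/2) * w' z - c * w z) z) (h0 : w 0 = 0) (h0' : w' 0 = 0) :
    ∀ z, w z = 0 := by
  intro z
  set R := |z| + 1 with hR
  have hRp : 0 < R := by positivity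
  have key := ODE_solution_unique_of_mem_Ioo (a := -R) (b := R) (t₀ := 0)
    (v := fun t (p : ℝ × ℝ) => (p.2, -(t/2) * p.2 - c * p.1)) (s := fun _ => Set.univ)
    (K := Real.toNNReal (R + |c| + 1))
    (f := fun t => (w t, w' t)) (g := fun _ => (0, 0)) ?_ ⟨by linarith, by linarith⟩ ?_ ?_ ?_
  · have hz : z ∈ Set.Ioo (-R) R := by
      have := abs_lt.1 (show |z| < R by linarith)
      exact this
    have := key hz
    simpa using congrArg Prod.fst this
  · intro t ht
    apply LipschitzWith.lipschitzOnWith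
    apply LipschitzWith.of_dist_le_mul
    intro p q
    rw [Real.coe_toNNReal _ (by positivity)]
    rw [dist_eq_norm, dist_eq_norm]
    have e1 : |p.1 - q.1| ≤ ‖p - q‖ := norm_fst_le (p - q)
    have e2 : |p.2 - q.2| ≤ ‖p - q‖ := norm_snd_le (p - q)
    have hn := norm_nonneg (p - q)
    have htR : |t| ≤ R := abs_le.2 ⟨ht.1.le, ht.2.le⟩
    refine norm_prod_le_iff.2 ⟨?_, ?_⟩
    · change |p.2 - q.2| ≤ _
      nlinarith [abs_nonneg c]
    · change |(-(t/2) * p.2 - c * p.1) - (-(t/2) * q.2 - c * q.1)| ≤ _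
      have : (-(t/2) * p.2 - c * p.1) - (-(t/2) * q.2 - c * q.1)
        = -(t/2) * (p.2 - q.2) - c * (p.1 - q.1) := by ring
      rw [this]
      refine (abs_sub _ _).trans ?_
      rw [abs_mul, abs_mul, abs_neg, abs_div, abs_two]
      have f1 : |t| / 2 * |p.2 - q.2| ≤ R * ‖p - q‖ := by
        gcongr; linarith [abs_nonneg t]
      have f2 : |c| * |p.1 - q.1| ≤ |c| * ‖p - q‖ := by gcongr
      linarith
  · intro t _
    exact ⟨(h1 t).prodMk (h2 t), trivial⟩
  · intro t _
    refine ⟨?_, trivial⟩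
    exact (hasDerivAt_const t ((0:ℝ), (0:ℝ))).congr_deriv (by simp; rfl)
  · simp [h0, h0']

lemma wronsk (c : ℝ) (f f' g g' : ℝ → ℝ) (hf : ∀ z, HasDerivAt f (f' z) z)
    (hf' : ∀ z, HasDerivAt f' (-(z/2) * f' z - c * f z) z)
    (hg : ∀ z, HasDerivAt g (g' z) z)
    (hg' : ∀ z, HasDerivAt g' (-(z/2) * g' z - c * g z) z) (z : ℝ) :
    (f z * g' z - f' z * g z) * Real.exp (z^2/4) = f 0 * g' 0 - f' 0 * g 0 := by
  have hd : ∀ z, HasDerivAt (fun z => (f z * g' z - f' z * g z) * Real.exp (z^2/4)) 0 z := by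
    intro z
    have he : HasDerivAt (fun z : ℝ => Real.exp (z^2/4)) (Real.exp (z^2/4) * (z/2)) z := by
      have : HasDerivAt (fun z : ℝ => z^2/4) (z/2) z := by
        exact ((hasDerivAt_pow 2 z).div_const 4).congr_deriv (by norm_num; ring)
      exact this.exp
    exact ((((hf z).mul (hg' z)).sub ((hf' z).mul (hg z))).mul he).congr_deriv (by
      simp only [Pi.mul_apply, Pi.sub_apply]
      ring)
  have := is_const_of_deriv_eq_zero (fun z => (hd z).differentiableAt) (fun z => (hd z).deriv) z 0
  simpa using this

lemma main (c : ℝ) (f f' g g' : ℝ → ℝ) (hf : ∀ z, HasDerivAt f (f' z) z)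
    (hf' : ∀ z, HasDerivAt f' (-(z/2) * f' z - c * f z) z)
    (hg : ∀ z, HasDerivAt g (g' z) z)
    (hg' : ∀ z, HasDerivAt g' (-(z/2) * g' z - c * g z) z)
    (h0 : f 0 = g 0) (hp : 0 < f 0)
    (A : ℝ) (hA : 0 ≤ A) (bf : ∀ z, 0 ≤ z → |f z| ≤ A * Real.exp (-z^2/5))
    (bf' : ∀ z, 0 ≤ z → |f' z| ≤ A * Real.exp (-z^2/5))
    (B : ℝ) (hB : 0 ≤ B) (bg : ∀ᶠ z in atTop, |g z| ≤ B * Real.exp (-z^2/5)) :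
    g = f := by
  have hW : f 0 * g' 0 - f' 0 * g 0 = 0 := by
    set W := f 0 * g' 0 - f' 0 * g 0 with hWd
    have hle : ∀ᶠ z in atTop, |W| ≤ (3 * A * B) * Real.exp (-z) := by
      obtain ⟨N, hN⟩ := eventually_atTop.1 bg
      filter_upwards [eventually_ge_atTop N, eventually_ge_atTop 11] with z hz hz11
      obtain ⟨x, hx, hxe⟩ := exists_hasDerivAt_eq_slope g g' (show z < z + 1 by linarith)
        (fun y _ => (hg y).continuousAt.continuousWithinAt) (fun y _ => hg y)
      have hmono : ∀ y, z ≤ y → Real.exp (-y^2/5) ≤ Real.exp (-z^2/5) := by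
        intro y hy
        apply Real.exp_le_exp.2
        nlinarith
      set E := Real.exp (-z^2/5) with hE
      have hE0 : 0 < E := Real.exp_pos _
      have g1 : |g (z+1)| ≤ B * E :=
        (hN (z+1) (by linarith)).trans (mul_le_mul_of_nonneg_left (hmono _ (by linarith)) hB)
      have g2 : |g z| ≤ B * E := hN z hz
      have g3 : |g x| ≤ B * E :=
        (hN x (by linarith [hx.1])).trans (mul_le_mul_of_nonneg_left (hmono _ hx.1.le) hB)
      have g4 : |g' x| ≤ 2 * (B * E) := by
        rw [hxe, add_sub_cancel_left, div_one]
        exact (abs_sub _ _).trans (by linarith)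
      have f1 : |f x| ≤ A * E :=
        (bf x (by linarith [hx.1])).trans (mul_le_mul_of_nonneg_left (hmono _ hx.1.le) hA)
      have f2 : |f' x| ≤ A * E :=
        (bf' x (by linarith [hx.1])).trans (mul_le_mul_of_nonneg_left (hmono _ hx.1.le) hA)
      have hw := wronsk c f f' g g' hf hf' hg hg' x
      rw [← hWd] at hw
      rw [← hw, abs_mul, abs_of_pos (Real.exp_pos _)]
      have k1 : |f x * g' x - f' x * g x| ≤ 3 * A * B * (E * E) := by
        refine (abs_sub _ _).trans ?_
        rw [abs_mul, abs_mul]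
        calc _ ≤ (A * E) * (2 * (B * E)) + (A * E) * (B * E) := by gcongr
          _ = _ := by ring
      have k2 : (E * E) * Real.exp (x^2/4) ≤ Real.exp (-z) := by
        rw [hE, ← Real.exp_add, ← Real.exp_add]
        apply Real.exp_le_exp.2
        have : x^2 ≤ (z+1)^2 := by
          have := hx.1; have := hx.2
          gcongr; linarith
        nlinarith
      calc _ ≤ 3 * A * B * (E * E) * Real.exp (x^2/4) := by gcongr
        _ = 3 * A * B * ((E * E) * Real.exp (x^2/4)) := by ring
        _ ≤ _ := by gcongr
    have ht : Tendsto (fun z : ℝ => (3 * A * B) * Real.exp (-z)) atTop (nhds 0) := by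
      simpa using (Real.tendsto_exp_neg_atTop_nhds_zero).const_mul (3 * A * B)
    have := ge_of_tendsto ht hle
    exact abs_eq_zero.1 (le_antisymm this (abs_nonneg _))
  have hd0 : g' 0 = f' 0 := by
    rw [← h0] at hW
    have : f 0 * (g' 0 - f' 0) = 0 := by linarith
    rcases mul_eq_zero.1 this with h | h <;> linarith
  funext z
  have := ode_unique c (fun z => g z - f z) (fun z => g' z - f' z)
    (fun z => (hg z).sub (hf z))
    (fun z => ((hg' z).sub (hf' z)).congr_deriv (by ring)) (by simp [h0]) (by simp [hd0]) z
  linarith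

lemma dexp (x : ℝ) : HasDerivAt (fun x : ℝ => Real.exp (-x^2/4)) (Real.exp (-x^2/4) * (-x/2)) x := by
  have : HasDerivAt (fun z : ℝ => -z^2/4) (-x/2) x := by
    exact ((hasDerivAt_pow 2 x).neg.div_const 4).congr_deriv (by norm_num; ring)
  exact this.exp

lemma fn_eq (n : ℕ) (z : ℝ) :
    fn n z = F (fun x => x * Real.exp (-x^2/4)) ((2:ℝ)^(-(n:ℝ)) - 1) z := by
  unfold fn F
  have := (measurePreserving_add_right (volume : Measure ℝ) z).setIntegral_preimage_emb
    (measurableEmbedding_addRight z)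
    (fun ξ => ξ * Real.exp (-ξ^2/4) * (ξ - z) ^ ((2:ℝ)^(-(n:ℝ)) - 1)) (Set.Ioi z)
  rw [← this]
  simp

lemma F_zero {a : ℝ} (ha : 0 < a) : F (fun x => x * Real.exp (-x^2/4)) (a - 1) 0
    = (2:ℝ) ^ a * Real.Gamma ((1 + a) / 2) := by
  have h := integral_rpow_mul_exp_neg_mul_rpow (p := 2) (q := a) (b := 1/4) (by norm_num)
    (by linarith) (by norm_num)
  have e : ((1:ℝ)/4) ^ (-(a+1)/2) * (1/2) = 2 ^ a := by
    have : (1:ℝ)/4 = 2 ^ (-2:ℝ) := by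
      rw [Real.rpow_neg (by norm_num)]; norm_num
    rw [this, ← Real.rpow_mul (by norm_num)]
    rw [show (-2:ℝ) * (-(a+1)/2) = a + 1 by ring, Real.rpow_add (by norm_num), Real.rpow_one]
    ring
  rw [e, add_comm a 1] at h
  rw [← h]
  unfold F
  refine setIntegral_congr_fun measurableSet_Ioi fun t ht => ?_
  have ht : 0 < t := ht
  simp only [add_zero]
  rw [Real.rpow_sub_one ht.ne', Real.rpow_two]
  have : -t^2/4 = -(1/4) * t^2 := by ring
  rw [this]
  field_simp

end S6

open S6 in
/-- For `n ≥ 1`, a twice continuously differentiable solution `g` of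
`g'' + (z/2) g' + (1 - 2^{-(n+1)}) g = 0` with `g(0) = 2^{2^{-n}} Γ((1+2^{-n})/2)` and
`limsup_{z→+∞} z^{2^{-n}-1} e^{z²/4} |g(z)| < ∞` equals `f_n`. -/
theorem stmt_6 (n : ℕ) (hn : 1 ≤ n) (g : ℝ → ℝ)
    (hg : ContDiff ℝ 2 g)
    (hode : ∀ z : ℝ, deriv (deriv g) z + z/2 * deriv g z
      + (1 - (2:ℝ)^(-(n:ℝ) - 1)) * g z = 0)
    (h0 : g 0 = (2:ℝ) ^ ((2:ℝ)^(-(n:ℝ))) * Real.Gamma ((1 + (2:ℝ)^(-(n:ℝ))) / 2))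
    (hbd : IsBoundedUnder (· ≤ ·) atTop
      (fun z : ℝ => z ^ ((2:ℝ)^(-(n:ℝ)) - 1) * Real.exp (z^2/4) * |g z|)) :
    g = fn n := by
  have hc : (1 - (2:ℝ)^(-(n:ℝ) - 1)) = 1 - (2:ℝ)^(-(n:ℝ)) / 2 := by
    rw [Real.rpow_sub_one (by norm_num)]
  rw [hc] at hode
  have hfn : fn n = F (fun x => x * Real.exp (-x^2/4)) ((2:ℝ)^(-(n:ℝ)) - 1) :=
    funext (fn_eq n)
  rw [hfn]
  have ha : 0 < (2:ℝ)^(-(n:ℝ)) := by positivity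
  generalize (2:ℝ)^(-(n:ℝ)) = a at *
  set k0 : ℝ → ℝ := fun x => x * Real.exp (-x^2/4) with hk0
  set k1 : ℝ → ℝ := fun x => (1 - x^2/2) * Real.exp (-x^2/4) with hk1
  set k2 : ℝ → ℝ := fun x => (x^3/4 - 3*x/2) * Real.exp (-x^2/4) with hk2
  have c0 : Continuous k0 := by fun_prop
  have c1 : Continuous k1 := by fun_prop
  have c2 : Continuous k2 := by fun_prop
  have b0 : Bd k0 1600 := bd_of_poly (fun x => x) fun x => by
    rw [abs_le]; constructor <;> nlinarith [sq_nonneg (x-1), sq_nonneg (x+1), sq_nonneg (x^2-1)]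
  have b1 : Bd k1 1600 := bd_of_poly (fun x => 1 - x^2/2) fun x => by
    rw [abs_le]; constructor <;> nlinarith [sq_nonneg (x-1), sq_nonneg (x+1), sq_nonneg (x^2-1)]
  have b2 : Bd k2 1600 := bd_of_poly (fun x => x^3/4 - 3*x/2) fun x => by
    rw [abs_le]; constructor <;>
      nlinarith [sq_nonneg (x-1), sq_nonneg (x+1), sq_nonneg (x^2-1), sq_nonneg (x^2-x),
        sq_nonneg (x^2+x)]
  have d0 : ∀ x, HasDerivAt k0 (k1 x) x := fun x => by
    exact ((hasDerivAt_id x).mul (dexp x)).congr_deriv (by simp only [hk1, id]; ring)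
  have d1 : ∀ x, HasDerivAt k1 (k2 x) x := fun x => by
    have : HasDerivAt (fun x : ℝ => 1 - x^2/2) (-x) x := by
      exact (((hasDerivAt_pow 2 x).div_const 2).const_sub 1).congr_deriv (by norm_num)
    exact (this.mul (dexp x)).congr_deriv (by simp only [hk2]; ring)
  have hs : -1 < a - 1 := by linarith
  have D0 := F_deriv c0 b0 c1 b1 d0 hs
  have D1 := F_deriv c1 b1 c2 b2 d1 hs
  have hF2 : ∀ z, F k2 (a-1) z = -(z/2) * F k1 (a-1) z - (1 - a/2) * F k0 (a-1) z := by
    intro z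
    have hp := F_parts c0 b0 c1 b1 d0 ha z
    have i0 := integ c0 b0 hs z
    have i1 := integ c1 b1 hs z
    have ia := integ c1 b1 (s := a) (by linarith) z
    have : F k2 (a-1) z = -(z/2) * F k1 (a-1) z - F k0 (a-1) z - (1/2) * F k1 a z := by
      have i2 : IntegrableOn (fun t => -(z/2) * (k1 (t + z) * t ^ (a - 1))
          - k0 (t + z) * t ^ (a - 1)) (Set.Ioi 0) := (i1.const_mul _).sub i0
      unfold F
      rw [← integral_const_mul, ← integral_const_mul, ← integral_sub (i1.const_mul _) i0,
        ← integral_sub i2 (ia.const_mul _)]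
      refine setIntegral_congr_fun measurableSet_Ioi fun t ht => ?_
      have ht : 0 < t := ht
      have e : t ^ a = t ^ (a - 1) * t := by
        rw [Real.rpow_sub_one ht.ne']; field_simp
      simp only [hk0, hk1, hk2, e]
      ring
    rw [this, hp]; ring
  obtain ⟨A0, hA0, B0⟩ := F_bound b0 hs
  obtain ⟨A1, hA1, B1⟩ := F_bound b1 hs
  obtain ⟨C, hC⟩ := hbd
  rw [eventually_map] at hC
  have hgd : ∀ z, HasDerivAt g (deriv g z) z := fun z =>
    (hg.differentiable (by norm_num) z).hasDerivAt
  have hgd2 : Differentiable ℝ (deriv g) :=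
    (hg.deriv' (n := 1)).differentiable (by norm_num)
  have hz := F_zero ha
  have hgam : 0 < Real.Gamma ((1 + a)/2) := Real.Gamma_pos_of_pos (by linarith)
  refine S6.main (1 - a/2) (F k0 (a-1)) (F k1 (a-1)) g (deriv g) D0
    (fun z => hF2 z ▸ D1 z) hgd (fun z => ?_) (hz.trans h0.symm) (by rw [hz]; positivity)
    (max A0 A1) (le_max_of_le_left hA0)
    (fun z hz => (B0 z hz).trans (by gcongr; exact le_max_left _ _))
    (fun z hz => (B1 z hz).trans (by gcongr; exact le_max_right _ _))
    (20 * max C 0) (by positivity) ?_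
  · have := (hgd2 z).hasDerivAt
    rwa [show deriv (deriv g) z = -(z/2) * deriv g z - (1 - a/2) * g z by linarith [hode z]] at this
  · filter_upwards [hC, eventually_ge_atTop 1] with z hz hz1
    have hz0 : 0 < z := by linarith
    have e1 : z⁻¹ ≤ z ^ (a - 1) := by
      rw [← Real.rpow_neg_one]
      exact Real.rpow_le_rpow_of_exponent_le hz1 (by linarith)
    have e2 : z⁻¹ * Real.exp (z^2/4) * |g z| ≤ max C 0 := by
      refine le_trans ?_ (hz.trans (le_max_left _ _))
      gcongr
    have e3 : z ≤ 20 * Real.exp (z^2/20) := by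
      have := Real.add_one_le_exp (z^2/20)
      nlinarith [sq_nonneg (z-1)]
    have e4 : |g z| = (z⁻¹ * Real.exp (z^2/4) * |g z|) * (z * Real.exp (-z^2/4)) := by
      have : Real.exp (z^2/4) * Real.exp (-z^2/4) = 1 := by
        rw [← Real.exp_add]; ring_nf; simp
      have h2 : z⁻¹ * z = 1 := inv_mul_cancel₀ hz0.ne'
      calc |g z| = (z⁻¹ * z) * (Real.exp (z^2/4) * Real.exp (-z^2/4)) * |g z| := by
            rw [this, h2]; ring
        _ = _ := by ring
    rw [e4]
    calc _ ≤ max C 0 * (20 * Real.exp (z^2/20) * Real.exp (-z^2/4)) := by gcongr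
      _ = 20 * max C 0 * (Real.exp (z^2/20) * Real.exp (-z^2/4)) := by ring
      _ = _ := by
        rw [← Real.exp_add]; congr 2; ring
end

section
/- For every real z, lim_{n→∞} 2^{-n} f_n(z) = z e^{-z²/4}, where the limit is taken over integers n → ∞. -/
open MeasureTheory Real Filter

lemma aux_int0 (z s : ℝ) (hs : -1 < s) :
    IntegrableOn (fun ξ : ℝ => Real.exp (-(ξ - z)) * (ξ - z) ^ s) (Set.Ioi z) := by
  have h := Real.GammaIntegral_convergent (s := s + 1) (by linarith)
  have h2 := ((measurePreserving_sub_right volume z).integrableOn_comp_preimage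
    (MeasurableEquiv.subRight z).measurableEmbedding).mpr h
  simpa [Function.comp_def] using h2

lemma aux_bd (ξ : ℝ) : (1 + ξ^2) * Real.exp (-ξ^2/4) ≤ 8 * Real.exp 2 * Real.exp (-ξ) := by
  have h1 : 1 + ξ^2 ≤ 8 * Real.exp (ξ^2/8) := by
    have := Real.add_one_le_exp (ξ^2/8)
    linarith
  have h2 : Real.exp (ξ^2/8) * Real.exp (-ξ^2/4) ≤ Real.exp 2 * Real.exp (-ξ) := by
    rw [← Real.exp_add, ← Real.exp_add]
    apply Real.exp_le_exp.mpr
    nlinarith [sq_nonneg (ξ - 4)]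
  have := mul_le_mul_of_nonneg_right h1 (Real.exp_pos (-ξ^2/4)).le
  linarith

lemma aux_bd2 (z ξ : ℝ) (p : ℝ) (hp : |p| ≤ 1 + ξ^2) :
    |p * Real.exp (-ξ^2/4)| ≤ 8 * Real.exp 2 * Real.exp (-z) * Real.exp (-(ξ - z)) := by
  rw [abs_mul, abs_of_pos (Real.exp_pos _)]
  refine (mul_le_mul_of_nonneg_right hp (Real.exp_pos _).le).trans ((aux_bd ξ).trans_eq ?_)
  rw [mul_assoc (8 * Real.exp 2), ← Real.exp_add]
  congr 2; ring

lemma aux_p1 (ξ : ℝ) : |ξ| ≤ 1 + ξ^2 := by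
  rw [abs_le]; constructor <;> nlinarith [sq_nonneg (ξ - 1), sq_nonneg (ξ + 1)]

lemma aux_p2 (ξ : ℝ) : |1 - ξ^2/2| ≤ 1 + ξ^2 := by
  rw [abs_le]; constructor <;> nlinarith [sq_nonneg ξ]

lemma aux_int (z s : ℝ) (hs : -1 < s) (p : ℝ → ℝ) (hc : Continuous p)
    (hp : ∀ ξ, |p ξ| ≤ 1 + ξ^2) :
    IntegrableOn (fun ξ : ℝ => p ξ * Real.exp (-ξ^2/4) * (ξ - z) ^ s) (Set.Ioi z) := by
  refine Integrable.mono' ((aux_int0 z s hs).const_mul (8 * Real.exp 2 * Real.exp (-z))) ?_ ?_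
  · apply Measurable.aestronglyMeasurable
    have := hc.measurable
    fun_prop
  · filter_upwards [ae_restrict_mem measurableSet_Ioi] with ξ hξ
    have h0 : 0 ≤ (ξ - z) ^ s := Real.rpow_nonneg (sub_nonneg.mpr (le_of_lt hξ)) _
    rw [Real.norm_eq_abs, abs_mul, abs_of_nonneg h0, ← mul_assoc]
    exact mul_le_mul_of_nonneg_right (aux_bd2 z ξ _ (hp ξ)) h0

lemma aux_deriv (ξ : ℝ) : HasDerivAt (fun ξ : ℝ => ξ * Real.exp (-ξ^2/4))
    ((1 - ξ^2/2) * Real.exp (-ξ^2/4)) ξ := by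
  have h1 : HasDerivAt (fun ξ : ℝ => -ξ^2/4) (-(2*ξ)/4) ξ := by
    simpa using ((hasDerivAt_pow 2 ξ).neg.div_const 4)
  refine ((hasDerivAt_id ξ).mul h1.exp).congr_deriv ?_
  simp only [id]; ring

lemma aux_tend (z s : ℝ) : Tendsto (fun ξ : ℝ => ξ * Real.exp (-ξ^2/4) * (ξ - z) ^ s)
    atTop (nhds 0) := by
  have h := (tendsto_rpow_mul_exp_neg_mul_atTop_nhds_zero s 1 one_pos).comp
    (tendsto_atTop_add_const_right atTop (-z) tendsto_id)
  have h2 := h.const_mul (8 * Real.exp 2 * Real.exp (-z))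
  rw [mul_zero] at h2
  refine squeeze_zero_norm' ?_ h2
  filter_upwards [eventually_gt_atTop z] with ξ hξ
  have h0 : 0 ≤ (ξ - z) ^ s := Real.rpow_nonneg (sub_nonneg.mpr (le_of_lt hξ)) _
  rw [Real.norm_eq_abs, abs_mul, abs_of_nonneg h0]
  refine (mul_le_mul_of_nonneg_right (aux_bd2 z ξ _ (aux_p1 ξ)) h0).trans_eq ?_
  simp only [Function.comp, id, ← sub_eq_add_neg, neg_mul, one_mul]
  ring

lemma aux_parts (z e : ℝ) (he : 0 < e) :
    e * ∫ ξ in Set.Ioi z, ξ * Real.exp (-ξ^2/4) * (ξ - z) ^ (e - 1) =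
    - ∫ ξ in Set.Ioi z, (1 - ξ^2/2) * Real.exp (-ξ^2/4) * (ξ - z) ^ e := by
  have i1 := aux_int z (e-1) (by linarith) (fun ξ => ξ) continuous_id aux_p1
  have i2 := aux_int z e (by linarith) (fun ξ => 1 - ξ^2/2) (by fun_prop) aux_p2
  have key := integral_Ioi_of_hasDerivAt_of_tendsto (a := z) (m := 0)
    (f := fun ξ : ℝ => ξ * Real.exp (-ξ^2/4) * (ξ - z) ^ e)
    (f' := fun ξ : ℝ => (1 - ξ^2/2) * Real.exp (-ξ^2/4) * (ξ - z) ^ e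
      + e * (ξ * Real.exp (-ξ^2/4) * (ξ - z) ^ (e - 1))) ?_ ?_ (i2.add (i1.const_mul e))
      (aux_tend z e)
  · rw [integral_add i2 (i1.const_mul e), integral_const_mul] at key
    simp only [sub_self, Real.zero_rpow he.ne', mul_zero] at key
    linarith
  · apply Continuous.continuousWithinAt
    have : Continuous (fun ξ : ℝ => (ξ - z) ^ e) :=
      (continuous_id.sub continuous_const).rpow_const (fun _ => Or.inr he.le)
    fun_prop
  · intro ξ hξ
    have h3 : HasDerivAt (fun ξ : ℝ => (ξ - z) ^ e) (1 * e * (ξ - z) ^ (e - 1)) ξ :=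
      ((hasDerivAt_id ξ).sub_const z).rpow_const (Or.inl (sub_pos.mpr hξ).ne')
    refine ((aux_deriv ξ).mul h3).congr_deriv ?_
    ring

lemma aux_zero (z : ℝ) :
    - ∫ ξ in Set.Ioi z, (1 - ξ^2/2) * Real.exp (-ξ^2/4) = z * Real.exp (-z^2/4) := by
  have i2 := aux_int z 0 (by linarith) (fun ξ => 1 - ξ^2/2) (by fun_prop) aux_p2
  have t := aux_tend z 0
  simp only [Real.rpow_zero, mul_one] at i2 t
  rw [integral_Ioi_of_hasDerivAt_of_tendsto' (fun ξ _ => aux_deriv ξ) i2 t]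
  ring

/-- For every real `z`, `lim_{n→∞} 2^{-n} f_n(z) = z e^{-z²/4}`. -/
theorem stmt_7 (z : ℝ) :
    Tendsto (fun n : ℕ => (2:ℝ)^(-(n:ℝ)) * fn n z) atTop
      (nhds (z * Real.exp (-z^2/4))) := by
  have he : ∀ n : ℕ, 0 < (2:ℝ)^(-(n:ℝ)) := fun n => by positivity
  have he1 : ∀ n : ℕ, (2:ℝ)^(-(n:ℝ)) ≤ 1 := fun n =>
    Real.rpow_le_one_of_one_le_of_nonpos (by norm_num) (by simp)
  have het : Tendsto (fun n : ℕ => (2:ℝ)^(-(n:ℝ))) atTop (nhds 0) := by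
    have := tendsto_pow_atTop_nhds_zero_of_lt_one (r := (1/2:ℝ)) (by norm_num) (by norm_num)
    refine this.congr fun n => ?_
    rw [Real.rpow_neg (by norm_num), Real.rpow_natCast]; simp
  simp only [fn, aux_parts z _ (he _)]
  rw [← aux_zero z]
  refine Tendsto.neg ?_
  have j0 := aux_int z 0 (by linarith) (fun ξ => 1 - ξ^2/2) (by fun_prop) aux_p2
  have j1 := aux_int z 1 (by linarith) (fun ξ => 1 - ξ^2/2) (by fun_prop) aux_p2
  refine tendsto_integral_of_dominated_convergence _
    (fun n => (aux_int z _ (by linarith [he n]) (fun ξ => 1 - ξ^2/2) (by fun_prop)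
      aux_p2).aestronglyMeasurable) (j0.norm.add j1.norm) ?_ ?_
  · intro n
    filter_upwards [ae_restrict_mem measurableSet_Ioi] with ξ hξ
    have hx : 0 < ξ - z := sub_pos.mpr hξ
    simp only [Pi.add_apply, Real.rpow_zero, Real.rpow_one]
    rw [norm_mul _ ((ξ - z) ^ _), norm_mul _ (1:ℝ), norm_mul _ (ξ - z), ← mul_add]
    refine mul_le_mul_of_nonneg_left ?_ (norm_nonneg _)
    rw [Real.norm_of_nonneg (Real.rpow_nonneg hx.le _), Real.norm_of_nonneg hx.le, norm_one]
    rcases le_total (ξ - z) 1 with h | h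
    · have := Real.rpow_le_one hx.le h (he n).le
      linarith
    · have := Real.rpow_le_rpow_of_exponent_le h (he1 n)
      rw [Real.rpow_one] at this
      linarith
  · filter_upwards [ae_restrict_mem measurableSet_Ioi] with ξ hξ
    have hx : 0 < ξ - z := sub_pos.mpr hξ
    have := (Real.continuous_const_rpow hx.ne').tendsto 0 |>.comp het
    rw [Real.rpow_zero] at this
    simpa using this.const_mul ((1 - ξ^2/2) * Real.exp (-ξ^2/4))
end

section
/- Let α, γ ∈ ℝ with γ ≠ 0, and let g_0 be the associated Burgers profile. Then: (i) g_0 is integrable on ℝ with ∫_{-∞}^{∞} g_0(z) dz = α; (ii) g_0 is smooth and satisfies g_0''(z) + (1/2) z g_0'(z) + (1/2) g_0(z) + γ (g_0²)'(z) = 0 for all z ∈ ℝ; consequently the function u_0(x,t) = (1+t)^{-1/2} g_0(x/√(1+t)) satisfies the viscous Burgers equation ∂_t u_0 = ∂_x² u_0 + γ ∂_x(u_0²) for all x ∈ ℝ and t > 0. -/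
open MeasureTheory Real Filter

/-- The error function `erf(x) = (2/√π) ∫_0^x e^{-s²} ds`. -/
noncomputable def erf (x : ℝ) : ℝ := 2 / Real.sqrt π * ∫ s in (0:ℝ)..x, Real.exp (-s^2)

/-- The Burgers profile `g₀(z) = T e^{-z²/4} / (γ √π (1 + T·erf(z/2)))` with `T = tanh(αγ/2)`. -/
noncomputable def g0 (α γ : ℝ) (z : ℝ) : ℝ :=
  Real.tanh (α * γ / 2) * Real.exp (-z^2/4) /
    (γ * Real.sqrt π * (1 + Real.tanh (α * γ / 2) * erf (z/2)))

/-- The self-similar solution `u₀(x,t) = (1+t)^{-1/2} g₀(x/√(1+t))`. -/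
noncomputable def burgersU0 (α γ : ℝ) (x t : ℝ) : ℝ :=
  g0 α γ (x / Real.sqrt (1 + t)) / Real.sqrt (1 + t)


lemma erf_hasDerivAt (x : ℝ) : HasDerivAt erf (2 / Real.sqrt π * Real.exp (-x^2)) x := by
  have hc : Continuous (fun s : ℝ => Real.exp (-s^2)) := by fun_prop
  exact (hc.integral_hasStrictDerivAt 0 x).hasDerivAt.const_mul (2 / Real.sqrt π)

lemma erf_contDiff : ContDiff ℝ (⊤ : ℕ∞) erf := by
  have h := contDiff_infty_iff_deriv (𝕜 := ℝ) (f := erf)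
  refine h.2 ⟨fun x => (erf_hasDerivAt x).differentiableAt, ?_⟩
  have : deriv erf = fun x => 2 / Real.sqrt π * Real.exp (-x^2) :=
    funext fun x => (erf_hasDerivAt x).deriv
  rw [this]
  fun_prop

lemma erf_tendsto_atTop : Tendsto erf atTop (nhds 1) := by
  have hi : Integrable (fun s : ℝ => Real.exp (-s^2)) := by
    simpa using integrable_exp_neg_mul_sq (b := 1) one_pos
  have h := intervalIntegral_tendsto_integral_Ioi 0 hi.integrableOn tendsto_id
  have e := integral_gaussian_Ioi 1
  simp only [neg_mul, one_mul, div_one] at e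
  rw [e] at h
  have h2 := h.const_mul (2 / Real.sqrt π)
  have hp : Real.sqrt π ≠ 0 := by positivity
  have : 2 / Real.sqrt π * (Real.sqrt π / 2) = 1 := by field_simp
  rw [this] at h2
  exact h2

lemma erf_odd (x : ℝ) : erf (-x) = - erf x := by
  unfold erf
  have := intervalIntegral.integral_comp_neg (a := 0) (b := x) (fun s : ℝ => Real.exp (-s^2))
  simp only [neg_sq, neg_zero] at this
  rw [this, intervalIntegral.integral_symm]
  ring

lemma erf_tendsto_atBot : Tendsto erf atBot (nhds (-1)) := by
  have h := (erf_tendsto_atTop.comp tendsto_neg_atBot_atTop).neg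
  refine h.congr fun x => ?_
  simp [erf_odd]

lemma erf_mono : Monotone erf := by
  refine monotone_of_deriv_nonneg (fun x => (erf_hasDerivAt x).differentiableAt) fun x => ?_
  rw [(erf_hasDerivAt x).deriv]
  positivity

lemma abs_erf_le (x : ℝ) : |erf x| ≤ 1 :=
  abs_le.2 ⟨erf_mono.le_of_tendsto erf_tendsto_atBot x, erf_mono.ge_of_tendsto erf_tendsto_atTop x⟩

lemma tanh_mem (x : ℝ) : |Real.tanh x| < 1 := Real.abs_tanh_lt_one x

lemma den_ge (a z : ℝ) : 1 - |Real.tanh a| ≤ 1 + Real.tanh a * erf z := by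
  have h1 : |Real.tanh a * erf z| ≤ |Real.tanh a| := by
    rw [abs_mul]
    exact mul_le_of_le_one_right (abs_nonneg _) (abs_erf_le z)
  have := neg_abs_le (Real.tanh a * erf z)
  linarith

lemma den_pos (a z : ℝ) : 0 < 1 + Real.tanh a * erf z := by
  have := den_ge a z
  have := tanh_mem a
  linarith

lemma den_hasDerivAt (a z : ℝ) : HasDerivAt (fun z => 1 + Real.tanh a * erf (z/2))
    (Real.tanh a * Real.exp (-z^2/4) / Real.sqrt π) z := by
  have h := (((erf_hasDerivAt (z/2)).comp z ((hasDerivAt_id z).div_const 2)).const_mul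
    (Real.tanh a)).const_add 1
  refine HasDerivAt.congr_deriv (f := fun z => 1 + Real.tanh a * erf (z/2)) h ?_
  rw [show -(z/2)^2 = -z^2/4 by ring]
  ring

lemma g0_contDiff (α γ : ℝ) (hγ : γ ≠ 0) : ContDiff ℝ (⊤ : ℕ∞) (g0 α γ) := by
  have he : ContDiff ℝ (⊤ : ℕ∞) (fun z : ℝ => erf (z/2)) := erf_contDiff.comp (by fun_prop)
  unfold g0
  refine ContDiff.div (by fun_prop) (by fun_prop) fun z => ?_
  have := den_pos (α * γ / 2) (z/2)
  have : 0 < Real.sqrt π := by positivity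
  positivity

lemma g0_hasDerivAt (α γ : ℝ) (hγ : γ ≠ 0) (z : ℝ) :
    HasDerivAt (g0 α γ) (-(z/2 * g0 α γ z) - γ * (g0 α γ z)^2) z := by
  have hD := (den_pos (α * γ / 2) (z/2)).ne'
  have hp : Real.sqrt π ≠ 0 := by positivity
  have hn : HasDerivAt (fun z : ℝ => Real.tanh (α * γ / 2) * Real.exp (-z^2/4))
      (Real.tanh (α * γ / 2) * (Real.exp (-z^2/4) * (-(z/2)))) z := by
    have h1 : HasDerivAt (fun z : ℝ => -z^2/4) (-(z/2)) z := by
      have := ((hasDerivAt_pow 2 z).neg).div_const 4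
      refine HasDerivAt.congr_deriv (f := fun z : ℝ => -z^2/4) this ?_
      norm_num; ring
    exact h1.exp.const_mul _
  have h := hn.div ((den_hasDerivAt (α * γ / 2) z).const_mul (γ * Real.sqrt π))
    (mul_ne_zero (mul_ne_zero hγ hp) hD)
  refine HasDerivAt.congr_deriv (f := g0 α γ) h ?_
  unfold g0
  set D := 1 + Real.tanh (α * γ / 2) * erf (z/2) with hDdef
  clear_value D
  field_simp

lemma g0_integrable (α γ : ℝ) (hγ : γ ≠ 0) : Integrable (g0 α γ) := by
  have hi : Integrable (fun z : ℝ => Real.exp (-(1/4) * z^2)) :=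
    integrable_exp_neg_mul_sq (by norm_num)
  refine (hi.const_mul (1 / (|γ| * Real.sqrt π * (1 - |Real.tanh (α * γ / 2)|)))).mono'
    (g0_contDiff α γ hγ).continuous.aestronglyMeasurable (Eventually.of_forall fun z => ?_)
  have hD := den_pos (α * γ / 2) (z/2)
  have hD2 := den_ge (α * γ / 2) (z/2)
  have hT := tanh_mem (α * γ / 2)
  have hT' : 0 < 1 - |Real.tanh (α * γ / 2)| := by linarith
  have hg : 0 < |γ| := abs_pos.2 hγ
  unfold g0
  rw [Real.norm_eq_abs, abs_div, abs_mul, abs_mul, abs_mul, abs_of_pos hD, Real.abs_exp,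
    abs_of_nonneg (Real.sqrt_nonneg _), show -z^2/4 = -(1/4) * z^2 by ring, div_mul_eq_mul_div]
  gcongr

lemma g0_integral (α γ : ℝ) (hγ : γ ≠ 0) : (∫ z : ℝ, g0 α γ z) = α := by
  have hT := abs_lt.1 (tanh_mem (α * γ / 2))
  have hp : Real.sqrt π ≠ 0 := by positivity
  have hder : ∀ z, HasDerivAt
      (fun z => Real.log (1 + Real.tanh (α * γ / 2) * erf (z/2)) / γ) (g0 α γ z) z := by
    intro z
    have hD := (den_pos (α * γ / 2) (z/2)).ne'
    refine HasDerivAt.congr_deriv (((den_hasDerivAt (α * γ / 2) z).log hD).div_const γ) ?_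
    unfold g0
    field_simp
  have htop : Tendsto (fun z : ℝ => Real.log (1 + Real.tanh (α * γ / 2) * erf (z/2)) / γ) atTop
      (nhds (Real.log (1 + Real.tanh (α * γ / 2) * 1) / γ)) := by
    refine Tendsto.div_const (Tendsto.log ?_ (by linarith)) _
    exact ((erf_tendsto_atTop.comp (tendsto_id.atTop_div_const two_pos)).const_mul _).const_add _
  have hbot : Tendsto (fun z : ℝ => Real.log (1 + Real.tanh (α * γ / 2) * erf (z/2)) / γ) atBot
      (nhds (Real.log (1 + Real.tanh (α * γ / 2) * (-1)) / γ)) := by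
    refine Tendsto.div_const (Tendsto.log ?_ (by linarith)) _
    exact ((erf_tendsto_atBot.comp (tendsto_id.atBot_div_const two_pos)).const_mul _).const_add _
  rw [integral_of_hasDerivAt_of_tendsto hder (g0_integrable α γ hγ) hbot htop]
  have ha := Real.artanh_tanh (α * γ / 2)
  rw [Real.artanh_eq_half_log ⟨hT.1.le, hT.2.le⟩, Real.log_div (by linarith) (by linarith)] at ha
  rw [mul_one, mul_neg_one, ← sub_eq_add_neg]
  field_simp
  linarith

lemma g0_deriv_eq (α γ : ℝ) (hγ : γ ≠ 0) :
    deriv (g0 α γ) = fun z => -(z/2 * g0 α γ z) - γ * (g0 α γ z)^2 :=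
  funext fun z => (g0_hasDerivAt α γ hγ z).deriv

lemma g0_deriv2 (α γ : ℝ) (hγ : γ ≠ 0) (z : ℝ) :
    HasDerivAt (deriv (g0 α γ)) (-(1/2 * g0 α γ z + z/2 * deriv (g0 α γ) z)
      - γ * (2 * g0 α γ z * deriv (g0 α γ) z)) z := by
  have hg : HasDerivAt (g0 α γ) (deriv (g0 α γ) z) z :=
    (g0_hasDerivAt α γ hγ z).differentiableAt.hasDerivAt
  have h := ((((hasDerivAt_id z).div_const 2).mul hg).neg).sub ((hg.pow 2).const_mul γ)
  have h' : HasDerivAt (fun z => -(z/2 * g0 α γ z) - γ * (g0 α γ z)^2) _ z := h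
  rw [← g0_deriv_eq α γ hγ] at h'
  convert h' using 1
  simp

/-- (i) `g₀` is integrable with total mass `α`; (ii) `g₀` is smooth and satisfies
`g₀'' + (1/2) z g₀' + (1/2) g₀ + γ (g₀²)' = 0`; consequently
`u₀(x,t) = (1+t)^{-1/2} g₀(x/√(1+t))` solves `∂_t u₀ = ∂_x² u₀ + γ ∂_x(u₀²)` for `t > 0`. -/
theorem stmt_8 (α γ : ℝ) (hγ : γ ≠ 0) :
    (Integrable (g0 α γ) ∧ (∫ z : ℝ, g0 α γ z) = α) ∧
    (ContDiff ℝ (⊤ : ℕ∞) (g0 α γ) ∧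
      ∀ z : ℝ, deriv (deriv (g0 α γ)) z + (1/2) * z * deriv (g0 α γ) z
        + (1/2) * g0 α γ z + γ * deriv (fun y => (g0 α γ y)^2) z = 0) ∧
    (∀ x : ℝ, ∀ t : ℝ, 0 < t →
      deriv (fun τ => burgersU0 α γ x τ) t =
        deriv (deriv (fun y => burgersU0 α γ y t)) x
          + γ * deriv (fun y => (burgersU0 α γ y t)^2) x) := by
  have hd : ∀ z, HasDerivAt (g0 α γ) (deriv (g0 α γ) z) z := fun z =>
    (g0_hasDerivAt α γ hγ z).differentiableAt.hasDerivAt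
  refine ⟨⟨g0_integrable α γ hγ, g0_integral α γ hγ⟩, ⟨g0_contDiff α γ hγ, fun z => ?_⟩, ?_⟩
  · have h2 : deriv (fun y => (g0 α γ y)^2) z = 2 * g0 α γ z * deriv (g0 α γ) z := by
      have h := ((hd z).pow 2).deriv
      change deriv (fun y => (g0 α γ y)^2) z = _ at h
      rw [h]
      norm_num
    rw [(g0_deriv2 α γ hγ z).deriv, h2]
    ring
  · intro x t ht
    have hs : 0 < Real.sqrt (1 + t) := Real.sqrt_pos.2 (by linarith)
    have hs' := hs.ne'
    have h1 : ∀ y, HasDerivAt (fun y => burgersU0 α γ y t)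
        (deriv (g0 α γ) (y / Real.sqrt (1 + t)) * (1 / Real.sqrt (1 + t)) / Real.sqrt (1 + t)) y :=
      fun y => (((hd _).comp y ((hasDerivAt_id y).div_const (Real.sqrt (1 + t)))).div_const _)
    have h1' : deriv (fun y => burgersU0 α γ y t) = fun y =>
        deriv (g0 α γ) (y / Real.sqrt (1 + t)) * (1 / Real.sqrt (1 + t)) / Real.sqrt (1 + t) :=
      funext fun y => (h1 y).deriv
    have h2 := ((((g0_deriv2 α γ hγ _).comp x
      ((hasDerivAt_id x).div_const (Real.sqrt (1 + t)))).mul_const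
        (1 / Real.sqrt (1 + t))).div_const (Real.sqrt (1 + t))).deriv
    have h3 := ((h1 x).pow 2).deriv
    have hq : HasDerivAt (fun τ : ℝ => Real.sqrt (1 + τ)) (1 / (2 * Real.sqrt (1 + t))) t :=
      ((hasDerivAt_id t).const_add 1).sqrt (by simp only [id]; linarith)
    have hx := (hasDerivAt_const t x).div hq hs'
    have h4 := (((hd (x / Real.sqrt (1 + t))).comp t hx).div hq hs').deriv
    rw [h1']
    change deriv (fun τ => burgersU0 α γ x τ) t = _ at h4
    change deriv (fun y => deriv (g0 α γ) (y / Real.sqrt (1 + t)) * (1 / Real.sqrt (1 + t))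
      / Real.sqrt (1 + t)) x = _ at h2
    change deriv (fun y => (burgersU0 α γ y t)^2) x = _ at h3
    rw [h2, h3, h4]
    simp only [burgersU0, id, Function.comp, Pi.div_apply]
    generalize deriv (g0 α γ) (x / Real.sqrt (1 + t)) = p
    generalize g0 α γ (x / Real.sqrt (1 + t)) = g
    generalize Real.sqrt (1 + t) = s at *
    norm_num
    field_simp
    ring
end

section
/- Let p₁, q₁, q₂, r₁ ≥ 0, let 0 ≤ p₂ < 1 and 0 ≤ r₂ ≤ 1 - p₂, and let r₃ ∈ {0,1}. Set β = min(p₁ + min(q₁ - 1, 0) + r₁, p₂ + q₂ + r₂ - 1) and α = max(δ_{q₁,1}, δ_{p₂+r₂,1} + r₃), where δ is the Kronecker delta. For t > 0 define B(t) = ∫_0^{t/2} (1+s)^{-q₁} (t-s)^{-p₁} (1+t-s)^{-r₁} ds + ∫_{t/2}^{t} (1+s)^{-q₂} (ln(2+s))^{r₃} (t-s)^{-p₂} (1+t-s)^{-r₂} ds. Then there exists C > 0 such that for all t > 0: if 0 ≤ p₁ ≤ 1 then B(t) ≤ C (ln(2+t))^{α} (1+t)^{-β}, and if p₁ > 1 then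 B(t) ≤ C (ln(2+t))^{α} t^{1-p₁} (1+t)^{p₁-1-β}. -/
open MeasureTheory Real Filter

lemma aux_mono {a b : ℝ} (hab : a ≤ b) {f g : ℝ → ℝ}
    (hf : ∀ s ∈ Set.Ioo a b, 0 ≤ f s) (hfg : ∀ s ∈ Set.Ioo a b, f s ≤ g s)
    (hg : IntervalIntegrable g volume a b) : ∫ s in a..b, f s ≤ ∫ s in a..b, g s := by
  rw [intervalIntegral.integral_of_le hab, intervalIntegral.integral_of_le hab,
    integral_Ioc_eq_integral_Ioo, integral_Ioc_eq_integral_Ioo]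
  apply integral_mono_of_nonneg
  · exact (ae_restrict_iff' measurableSet_Ioo).2 (Eventually.of_forall hf)
  · exact ((intervalIntegrable_iff_integrableOn_Ioo_of_le hab).1 hg)
  · exact (ae_restrict_iff' measurableSet_Ioo).2 (Eventually.of_forall hfg)

lemma aux_int_s12 (q : ℝ) {a T : ℝ} (ha : 0 ≤ a) (hT : 0 ≤ T) :
    IntervalIntegrable (fun s : ℝ => (1 + s) ^ (-q)) volume a T := by
  apply ContinuousOn.intervalIntegrable
  intro x hx
  have hx0 : 0 ≤ x := le_trans (le_min ha hT) hx.1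
  apply ContinuousAt.continuousWithinAt
  exact ContinuousAt.rpow_const (by fun_prop) (Or.inl (by linarith))

lemma aux_log {t : ℝ} (ht : 0 < t) : Real.log 2 ≤ Real.log (2 + t) :=
  Real.log_le_log (by norm_num) (by linarith)

lemma aux_log2 {t : ℝ} (ht : 0 < t) : 0 < Real.log (2 + t) :=
  Real.log_pos (by linarith)

lemma aux_L {δ α : ℝ} (h : δ ≤ α) : ∃ C : ℝ, 0 < C ∧ ∀ t : ℝ, 0 < t →
    Real.log (2 + t) ^ δ ≤ C * Real.log (2 + t) ^ α := by
  have h2 : 0 < Real.log 2 := Real.log_pos (by norm_num)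
  refine ⟨Real.log 2 ^ (δ - α), rpow_pos_of_pos h2 _, fun t ht => ?_⟩
  have hL := aux_log2 ht
  have : Real.log (2 + t) ^ δ = Real.log (2 + t) ^ (δ - α) * Real.log (2 + t) ^ α := by
    rw [← rpow_add hL]; congr 1; ring
  rw [this]
  gcongr ?_ * _
  exact rpow_le_rpow_of_nonpos h2 (aux_log ht) (by linarith)

lemma aux_half {r : ℝ} (hr : 0 ≤ r) {t : ℝ} (ht : 0 < t) :
    (1 + t / 2) ^ (-r) ≤ 2 ^ r * (1 + t) ^ (-r) := by
  have : (2:ℝ) ^ r * (1 + t) ^ (-r) = ((1 + t) / 2) ^ (-r) := by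
    rw [div_rpow (by linarith) (by norm_num), rpow_neg (by norm_num : (0:ℝ) ≤ 2)]
    field_simp
  rw [this]
  exact rpow_le_rpow_of_nonpos (by linarith) (by linarith) (by linarith)

lemma aux_one {T : ℝ} (a : ℝ) (ha : 0 ≤ a) (hT : 0 ≤ T) :
    ∫ s in a..T, (1 + s) ^ (-1 : ℝ) = Real.log ((1 + T) / (1 + a)) := by
  rw [intervalIntegral.integral_comp_add_left (fun s : ℝ => s ^ (-1 : ℝ))]
  simp_rw [rpow_neg_one]
  rw [integral_inv_of_pos (by linarith) (by linarith)]

lemma aux_A0 (q : ℝ) : ∃ C : ℝ, 0 < C ∧ ∀ t : ℝ, 0 < t →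
    ∫ s in (0:ℝ)..(t/2), (1 + s) ^ (-q) ≤
      C * (Real.log (2 + t) ^ (if q = 1 then (1:ℝ) else 0) * (1 + t) ^ (-(min (q - 1) 0))) := by
  by_cases hq : q = 1
  · refine ⟨1, one_pos, fun t ht => ?_⟩
    subst hq
    rw [aux_one 0 le_rfl (by linarith)]
    simp only [if_true, sub_self, min_self, neg_zero, rpow_zero, rpow_one, mul_one, one_mul,
      add_zero, div_one]
    exact Real.log_le_log (by linarith) (by linarith)
  · have hne : 1 - q ≠ 0 := fun h => hq (by linarith)
    refine ⟨1 / |1 - q|, by positivity, fun t ht => ?_⟩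
    rw [intervalIntegral.integral_comp_add_left (fun s : ℝ => s ^ (-q)),
      integral_rpow (Or.inr ⟨fun h => hq (by linarith), ?_⟩)]
    · simp only [if_neg hq, rpow_zero, one_mul, add_zero, one_rpow]
      rw [show -q + 1 = 1 - q by ring]
      rcases lt_or_gt_of_ne hq with h | h
      · rw [abs_of_pos (by linarith), min_eq_left (by linarith), one_div, mul_comm,
          ← div_eq_mul_inv]
        have : (1 + t / 2) ^ (1 - q) ≤ (1 + t) ^ (1 - q) :=
          rpow_le_rpow (by linarith) (by linarith) (by linarith)
        rw [neg_sub]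
        have : 0 < 1 - q := by linarith
        gcongr
        linarith
      · rw [abs_of_neg (by linarith), min_eq_right (by linarith), neg_zero, rpow_zero, mul_one,
          ← neg_div_neg_eq]
        have : 0 < -(1 - q) := by linarith
        gcongr
        have : 0 < (1 + t / 2) ^ (1 - q) := rpow_pos_of_pos (by linarith) _
        linarith
    · rw [Set.uIcc_of_le (by linarith)]
      rintro ⟨h1, h2⟩
      linarith

lemma aux_A {q : ℝ} (hq : 0 ≤ q) : ∃ C : ℝ, 0 < C ∧ ∀ t : ℝ, 0 < t →
    ∫ s in (0:ℝ)..(t/2), (1 + s) ^ (-q) ≤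
      C * (t / (1 + t)) *
        (Real.log (2 + t) ^ (if q = 1 then (1:ℝ) else 0) * (1 + t) ^ (-(min (q - 1) 0))) := by
  obtain ⟨C, hC, h⟩ := aux_A0 q
  obtain ⟨D, hD, h'⟩ := aux_L (δ := 0) (α := if q = 1 then (1:ℝ) else 0) (by split_ifs <;> norm_num)
  refine ⟨2 * C + D, by positivity, fun t ht => ?_⟩
  have hL := aux_log2 ht
  set G := Real.log (2 + t) ^ (if q = 1 then (1:ℝ) else 0) * (1 + t) ^ (-(min (q - 1) 0)) with hG
  have hGp : 0 < G := mul_pos (rpow_pos_of_pos hL _) (rpow_pos_of_pos (by linarith) _)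
  rcases le_total 1 t with h1 | h1
  · refine (h t ht).trans ?_
    gcongr
    have : 1 ≤ 2 * (t / (1 + t)) := by
      rw [← mul_div_assoc, le_div_iff₀ (by linarith)]; linarith
    have h3 : 0 ≤ D * (t / (1 + t)) := by positivity
    nlinarith
  · have h2 : ∫ s in (0:ℝ)..(t/2), (1 + s) ^ (-q) ≤ ∫ s in (0:ℝ)..(t/2), (1:ℝ) := by
      apply aux_mono (by linarith)
      · intro s hs; exact rpow_nonneg (by linarith [hs.1]) _
      · intro s hs; exact rpow_le_one_of_one_le_of_nonpos (by linarith [hs.1]) (by linarith)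
      · simp
    refine h2.trans ?_
    simp only [intervalIntegral.integral_const, sub_zero, smul_eq_mul, mul_one]
    have h3 : 1 ≤ D * G := by
      have h4 := h' t ht
      rw [rpow_zero] at h4
      have h5 : 1 ≤ (1 + t) ^ (-(min (q - 1) 0)) :=
        one_le_rpow (by linarith) (by linarith [min_le_right (q - 1) 0])
      rw [hG, ← mul_assoc]
      nlinarith
    have h4 : t / 2 ≤ t / (1 + t) := by gcongr; linarith
    have h6 : 0 ≤ t / (1 + t) := by positivity
    have h5 : 0 ≤ 2 * C * (t / (1 + t)) * G := by positivity
    nlinarith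

lemma aux_Bint {p : ℝ} (r : ℝ) (hp : p < 1) {a T : ℝ} (ha : 0 ≤ a) (hT : 0 ≤ T) :
    IntervalIntegrable (fun u : ℝ => u ^ (-p) * (1 + u) ^ (-r)) volume a T := by
  apply (intervalIntegral.intervalIntegrable_rpow' (by linarith)).mul_continuousOn
  intro x hx
  have hx0 : 0 ≤ x := le_trans (le_min ha hT) hx.1
  apply ContinuousAt.continuousWithinAt
  exact ContinuousAt.rpow_const (by fun_prop) (Or.inl (by linarith))

lemma aux_B {p r : ℝ} (hp0 : 0 ≤ p) (hp : p < 1) (hr0 : 0 ≤ r) (hr : r ≤ 1 - p) :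
    ∃ C : ℝ, 0 < C ∧ ∀ t : ℝ, 0 < t →
    ∫ u in (0:ℝ)..(t/2), u ^ (-p) * (1 + u) ^ (-r) ≤
      C * (Real.log (2 + t) ^ (if p + r = 1 then (1:ℝ) else 0) * (1 + t) ^ (1 - p - r)) := by
  by_cases h : p + r = 1
  · have hr' : r = 1 - p := by linarith
    have h2 : 0 < Real.log 2 := Real.log_pos (by norm_num)
    have hp1 : 0 < 1 - p := by linarith
    have key : ∀ T : ℝ, 0 ≤ T → T ≤ 1 →
        ∫ u in (0:ℝ)..T, u ^ (-p) * (1 + u) ^ (-r) ≤ 1 / (1 - p) := by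
      intro T hT hT1
      have : ∫ u in (0:ℝ)..T, u ^ (-p) * (1 + u) ^ (-r) ≤ ∫ u in (0:ℝ)..T, u ^ (-p) := by
        apply aux_mono hT
        · intro s hs
          exact mul_nonneg (rpow_nonneg hs.1.le _) (rpow_nonneg (by linarith [hs.1]) _)
        · intro s hs
          exact mul_le_of_le_one_right (rpow_nonneg hs.1.le _)
            (rpow_le_one_of_one_le_of_nonpos (by linarith [hs.1]) (by linarith))
        · exact intervalIntegral.intervalIntegrable_rpow' (by linarith)
      refine this.trans ?_
      rw [integral_rpow (Or.inl (by linarith)), show -p + 1 = 1 - p by ring,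
        zero_rpow hp1.ne', sub_zero]
      gcongr
      exact rpow_le_one hT hT1 hp1.le
    refine ⟨1 / (1 - p) / Real.log 2 + 2 ^ p, by positivity, fun t ht => ?_⟩
    have hL := aux_log2 ht
    have hLL := aux_log ht
    simp only [if_pos h]
    rw [show 1 - p - r = 0 by linarith, rpow_zero, rpow_one, mul_one, add_mul]
    have hA : 1 / (1 - p) ≤ 1 / (1 - p) / Real.log 2 * Real.log (2 + t) := by
      rw [div_mul_eq_mul_div, le_div_iff₀ h2]
      gcongr
    have hB : 0 ≤ (2:ℝ) ^ p * Real.log (2 + t) := by positivity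
    rcases le_total (t / 2) 1 with h1 | h1
    · linarith [key (t/2) (by linarith) h1]
    · rw [← intervalIntegral.integral_add_adjacent_intervals (b := 1)
        (aux_Bint r hp le_rfl zero_le_one) (aux_Bint r hp zero_le_one (by linarith))]
      have h3 : ∫ u in (1:ℝ)..(t/2), u ^ (-p) * (1 + u) ^ (-r) ≤
          ∫ u in (1:ℝ)..(t/2), 2 ^ p * (1 + u) ^ (-1 : ℝ) := by
        apply aux_mono h1
        · intro s hs
          exact mul_nonneg (rpow_nonneg (by linarith [hs.1]) _)
            (rpow_nonneg (by linarith [hs.1]) _)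
        · intro s hs
          have hs1 := hs.1
          have e1 : s ^ (-p) ≤ 2 ^ p * (1 + s) ^ (-p) := by
            have e : (2:ℝ) ^ p * (1 + s) ^ (-p) = ((1 + s) / 2) ^ (-p) := by
              rw [div_rpow (by linarith) (by norm_num), rpow_neg (by norm_num : (0:ℝ) ≤ 2)]
              field_simp
            rw [e]
            exact rpow_le_rpow_of_nonpos (by linarith) (by linarith) (by linarith)
          calc s ^ (-p) * (1 + s) ^ (-r) ≤ 2 ^ p * (1 + s) ^ (-p) * (1 + s) ^ (-r) := by
                gcongr
            _ = _ := by
                rw [mul_assoc, ← rpow_add (by linarith)]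
                congr 2; linarith
        · exact (aux_int_s12 1 zero_le_one (by linarith)).const_mul _
      rw [intervalIntegral.integral_const_mul, aux_one 1 zero_le_one (by linarith)] at h3
      have h4 : Real.log ((1 + t / 2) / (1 + 1)) ≤ Real.log (2 + t) :=
        Real.log_le_log (by positivity) (by linarith)
      have h5 : (2:ℝ) ^ p * Real.log ((1 + t / 2) / (1 + 1)) ≤ 2 ^ p * Real.log (2 + t) := by
        gcongr
      linarith [key 1 zero_le_one le_rfl]
  · have hlt : 0 < 1 - p - r := lt_of_le_of_ne (by linarith) (fun h' => h (by linarith))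
    refine ⟨1 / (1 - p - r), by positivity, fun t ht => ?_⟩
    simp only [if_neg h, rpow_zero, one_mul]
    have : ∫ u in (0:ℝ)..(t/2), u ^ (-p) * (1 + u) ^ (-r) ≤
        ∫ u in (0:ℝ)..(t/2), u ^ (-p - r) := by
      apply aux_mono (by linarith)
      · intro s hs
        exact mul_nonneg (rpow_nonneg hs.1.le _) (rpow_nonneg (by linarith [hs.1]) _)
      · intro s hs
        rw [sub_eq_add_neg, rpow_add hs.1]
        have := rpow_nonneg hs.1.le (-p)
        gcongr ?_ * ?_
        exact rpow_le_rpow_of_nonpos hs.1 (by linarith) (by linarith)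
      · exact intervalIntegral.intervalIntegrable_rpow' (by linarith)
    refine this.trans ?_
    rw [integral_rpow (Or.inl (by linarith)), show -p - r + 1 = 1 - p - r by ring,
      zero_rpow hlt.ne', sub_zero, one_div_mul_eq_div]
    gcongr
    linarith

lemma aux_I1 {p q r α β : ℝ} (hp : 0 ≤ p) (hq : 0 ≤ q) (hr : 0 ≤ r)
    (hα : (if q = 1 then (1:ℝ) else 0) ≤ α) (hβ : β ≤ p + min (q - 1) 0 + r) :
    ∃ C : ℝ, 0 < C ∧ ∀ t : ℝ, 0 < t →
    ∫ s in (0:ℝ)..(t/2), (1 + s) ^ (-q) * (t - s) ^ (-p) * (1 + t - s) ^ (-r) ≤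
      C * (Real.log (2 + t) ^ α * (t ^ (1 - p) * (1 + t) ^ (p - 1)) * (1 + t) ^ (-β)) := by
  obtain ⟨C, hC, h⟩ := aux_A hq
  obtain ⟨D, hD, h'⟩ := aux_L hα
  refine ⟨C * D * 2 ^ p * 2 ^ r, by positivity, fun t ht => ?_⟩
  have hL := aux_log2 ht
  have h1t : 0 < 1 + t := by linarith
  have e1 : ∫ s in (0:ℝ)..(t/2), (1 + s) ^ (-q) * (t - s) ^ (-p) * (1 + t - s) ^ (-r) ≤
      ∫ s in (0:ℝ)..(t/2), (1 + s) ^ (-q) * ((t / 2) ^ (-p) * (1 + t / 2) ^ (-r)) := by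
    apply aux_mono (by linarith)
    · intro s hs
      have h1 := hs.1
      have h2 := hs.2
      exact mul_nonneg (mul_nonneg (rpow_nonneg (by linarith) _) (rpow_nonneg (by linarith) _))
        (rpow_nonneg (by linarith) _)
    · intro s hs
      have h1 := hs.1
      have h2 := hs.2
      rw [mul_assoc]
      have a1 : (t - s) ^ (-p) ≤ (t / 2) ^ (-p) :=
        rpow_le_rpow_of_nonpos (by linarith) (by linarith) (by linarith)
      have a2 : (1 + t - s) ^ (-r) ≤ (1 + t / 2) ^ (-r) :=
        rpow_le_rpow_of_nonpos (by linarith) (by linarith) (by linarith)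
      have a3 : 0 ≤ (1 + s) ^ (-q) := rpow_nonneg (by linarith) _
      have a4 : 0 ≤ (1 + t - s) ^ (-r) := rpow_nonneg (by linarith) _
      gcongr
    · exact (aux_int_s12 q le_rfl (by linarith)).mul_const _
  rw [intervalIntegral.integral_mul_const] at e1
  refine e1.trans ?_
  have e2 : (t / 2) ^ (-p) = 2 ^ p * t ^ (-p) := by
    rw [div_rpow ht.le (by norm_num), rpow_neg (by norm_num : (0:ℝ) ≤ 2)]
    field_simp
  have e3 := aux_half hr ht
  have e4 := h t ht
  have e5 := h' t ht
  calc _ ≤ (C * (t / (1 + t)) * ((D * Real.log (2 + t) ^ α) * (1 + t) ^ (-(min (q - 1) 0)))) *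
        ((2 ^ p * t ^ (-p)) * (2 ^ r * (1 + t) ^ (-r))) := by
        rw [e2]
        gcongr
        refine e4.trans ?_
        gcongr
    _ = C * D * 2 ^ p * 2 ^ r * (Real.log (2 + t) ^ α * (t ^ (1 - p) * (1 + t) ^ (p - 1)) *
        (1 + t) ^ (-(p + min (q - 1) 0 + r))) := by
        have f1 : t ^ (1 - p) = t * t ^ (-p) := by
          rw [sub_eq_add_neg, rpow_add ht, rpow_one]
        have f2 : (1 + t) ^ (p - 1) * (1 + t) ^ (-(p + min (q - 1) 0 + r)) =
            (1 + t)⁻¹ * (1 + t) ^ (-(min (q - 1) 0)) * (1 + t) ^ (-r) := by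
          rw [← rpow_neg_one, ← rpow_add h1t, ← rpow_add h1t, ← rpow_add h1t]
          congr 1; ring
        rw [mul_assoc (Real.log (2 + t) ^ α), mul_assoc (t ^ (1 - p)), f2, f1, div_eq_mul_inv]
        ring
    _ ≤ _ := by
        gcongr
        linarith

lemma aux_I2 {p q r r₃ α β : ℝ} (hp0 : 0 ≤ p) (hp : p < 1) (hq : 0 ≤ q) (hr : 0 ≤ r)
    (hr1 : r ≤ 1 - p) (hr₃ : 0 ≤ r₃)
    (hα : (if p + r = 1 then (1:ℝ) else 0) + r₃ ≤ α) (hβ : β ≤ p + q + r - 1) :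
    ∃ C : ℝ, 0 < C ∧ ∀ t : ℝ, 0 < t →
    ∫ s in (t/2)..t,
      (1 + s) ^ (-q) * (Real.log (2 + s)) ^ r₃ * (t - s) ^ (-p) * (1 + t - s) ^ (-r) ≤
      C * (Real.log (2 + t) ^ α * (1 + t) ^ (-β)) := by
  obtain ⟨C, hC, h⟩ := aux_B hp0 hp hr hr1
  obtain ⟨D, hD, h'⟩ := aux_L hα
  refine ⟨C * D * 2 ^ q, by positivity, fun t ht => ?_⟩
  have hL := aux_log2 ht
  have h1t : 0 < 1 + t := by linarith
  have hsub : ∫ s in (t/2)..t, (t - s) ^ (-p) * (1 + (t - s)) ^ (-r) =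
      ∫ u in (0:ℝ)..(t/2), u ^ (-p) * (1 + u) ^ (-r) := by
    rw [intervalIntegral.integral_comp_sub_left (fun u : ℝ => u ^ (-p) * (1 + u) ^ (-r))]
    congr 1 <;> ring
  have hint : IntervalIntegrable (fun s : ℝ => (t - s) ^ (-p) * (1 + (t - s)) ^ (-r))
      volume (t/2) t := by
    have := (aux_Bint r hp (le_refl (0:ℝ)) (by linarith : 0 ≤ t / 2)).comp_sub_left t
    rw [sub_zero, show t - t / 2 = t / 2 by ring] at this
    exact this.symm
  have e1 : ∫ s in (t/2)..t,
      (1 + s) ^ (-q) * (Real.log (2 + s)) ^ r₃ * (t - s) ^ (-p) * (1 + t - s) ^ (-r) ≤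
      ∫ s in (t/2)..t, ((1 + t / 2) ^ (-q) * Real.log (2 + t) ^ r₃) *
        ((t - s) ^ (-p) * (1 + (t - s)) ^ (-r)) := by
    apply aux_mono (by linarith)
    · intro s hs
      have h1 := hs.1
      have h2 := hs.2
      exact mul_nonneg (mul_nonneg (mul_nonneg (rpow_nonneg (by linarith) _)
        (rpow_nonneg (Real.log_nonneg (by linarith)) _)) (rpow_nonneg (by linarith) _))
        (rpow_nonneg (by linarith) _)
    · intro s hs
      have h1 := hs.1
      have h2 := hs.2
      rw [mul_assoc, ← add_sub_assoc]
      have a1 : (1 + s) ^ (-q) ≤ (1 + t / 2) ^ (-q) :=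
        rpow_le_rpow_of_nonpos (by linarith) (by linarith) (by linarith)
      have a0 : 0 ≤ Real.log (2 + s) := Real.log_nonneg (by linarith)
      have a2 : Real.log (2 + s) ^ r₃ ≤ Real.log (2 + t) ^ r₃ :=
        rpow_le_rpow a0 (Real.log_le_log (by linarith) (by linarith)) hr₃
      have a3 : 0 ≤ (t - s) ^ (-p) := rpow_nonneg (by linarith) _
      have a4 : 0 ≤ (1 + t - s) ^ (-r) := rpow_nonneg (by linarith) _
      gcongr
    · exact hint.const_mul _
  rw [intervalIntegral.integral_const_mul, hsub] at e1
  refine e1.trans ?_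
  have e3 := aux_half hq ht
  have e4 := h t ht
  have e5 := h' t ht
  calc _ ≤ (2 ^ q * (1 + t) ^ (-q) * Real.log (2 + t) ^ r₃) *
        (C * (Real.log (2 + t) ^ (if p + r = 1 then (1:ℝ) else 0) * (1 + t) ^ (1 - p - r))) := by
        exact mul_le_mul (by gcongr) e4 (intervalIntegral.integral_nonneg (by linarith) fun u hu => mul_nonneg (rpow_nonneg hu.1 _) (rpow_nonneg (by linarith [hu.1]) _)) (by positivity)
    _ = C * 2 ^ q * (Real.log (2 + t) ^ ((if p + r = 1 then (1:ℝ) else 0) + r₃) *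
          (1 + t) ^ (-(p + q + r - 1))) := by
        rw [rpow_add hL, show -(p + q + r - 1) = -q + (1 - p - r) by ring, rpow_add h1t]
        ring
    _ ≤ C * 2 ^ q * (D * Real.log (2 + t) ^ α * (1 + t) ^ (-β)) := by
        gcongr
        linarith
    _ = _ := by ring

/-- bound on the convolution-type integral
`B(t) = ∫_0^{t/2} (1+s)^{-q₁} (t-s)^{-p₁} (1+t-s)^{-r₁} ds
      + ∫_{t/2}^t (1+s)^{-q₂} (ln(2+s))^{r₃} (t-s)^{-p₂} (1+t-s)^{-r₂} ds`,
with `β = min(p₁ + min(q₁-1,0) + r₁, p₂ + q₂ + r₂ - 1)` and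
`α = max(δ_{q₁,1}, δ_{p₂+r₂,1} + r₃)`. -/
theorem stmt_12 (p₁ q₁ q₂ r₁ p₂ r₂ r₃ : ℝ)
    (hp₁ : 0 ≤ p₁) (hq₁ : 0 ≤ q₁) (hq₂ : 0 ≤ q₂) (hr₁ : 0 ≤ r₁)
    (hp₂0 : 0 ≤ p₂) (hp₂1 : p₂ < 1) (hr₂0 : 0 ≤ r₂) (hr₂1 : r₂ ≤ 1 - p₂)
    (hr₃ : r₃ = 0 ∨ r₃ = 1) :
    ∃ C : ℝ, 0 < C ∧ ∀ t : ℝ, 0 < t →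
      (0 ≤ p₁ → p₁ ≤ 1 →
        ((∫ s in (0:ℝ)..(t/2), (1 + s) ^ (-q₁) * (t - s) ^ (-p₁) * (1 + t - s) ^ (-r₁)) +
         (∫ s in (t/2)..t,
            (1 + s) ^ (-q₂) * (Real.log (2 + s)) ^ r₃ * (t - s) ^ (-p₂) * (1 + t - s) ^ (-r₂)))
          ≤ C * (Real.log (2 + t)) ^
              (max (if q₁ = 1 then (1:ℝ) else 0) ((if p₂ + r₂ = 1 then (1:ℝ) else 0) + r₃))
            * (1 + t) ^
              (-(min (p₁ + min (q₁ - 1) 0 + r₁) (p₂ + q₂ + r₂ - 1)))) ∧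
      (1 < p₁ →
        ((∫ s in (0:ℝ)..(t/2), (1 + s) ^ (-q₁) * (t - s) ^ (-p₁) * (1 + t - s) ^ (-r₁)) +
         (∫ s in (t/2)..t,
            (1 + s) ^ (-q₂) * (Real.log (2 + s)) ^ r₃ * (t - s) ^ (-p₂) * (1 + t - s) ^ (-r₂)))
          ≤ C * (Real.log (2 + t)) ^
              (max (if q₁ = 1 then (1:ℝ) else 0) ((if p₂ + r₂ = 1 then (1:ℝ) else 0) + r₃))
            * t ^ (1 - p₁)
            * (1 + t) ^
              (p₁ - 1 - (min (p₁ + min (q₁ - 1) 0 + r₁) (p₂ + q₂ + r₂ - 1)))) := by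
  set β := min (p₁ + min (q₁ - 1) 0 + r₁) (p₂ + q₂ + r₂ - 1) with hβ
  set α := max (if q₁ = 1 then (1:ℝ) else 0) ((if p₂ + r₂ = 1 then (1:ℝ) else 0) + r₃) with hα
  have hr3 : 0 ≤ r₃ := by rcases hr₃ with h | h <;> rw [h] <;> norm_num
  obtain ⟨C, hC, h⟩ := aux_I1 (α := α) (β := β) hp₁ hq₁ hr₁ (le_max_left _ _) (min_le_left _ _)
  obtain ⟨D, hD, h'⟩ := aux_I2 (α := α) (β := β) hp₂0 hp₂1 hq₂ hr₂0 hr₂1 hr3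
    (le_max_right _ _) (min_le_right _ _)
  refine ⟨C + D, by positivity, fun t ht => ?_⟩
  have a1 := h t ht
  have a2 := h' t ht
  have h1t : 0 < 1 + t := by linarith
  have hX : 0 < Real.log (2 + t) ^ α := rpow_pos_of_pos (aux_log2 ht) _
  have hY : 0 < (1 + t) ^ (-β) := rpow_pos_of_pos h1t _
  have hZ : t ^ (1 - p₁) * (1 + t) ^ (p₁ - 1) = (t / (1 + t)) ^ (1 - p₁) := by
    rw [div_rpow ht.le h1t.le, show p₁ - 1 = -(1 - p₁) by ring, rpow_neg h1t.le, div_eq_mul_inv]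
  have hq0 : 0 < t / (1 + t) := by positivity
  have hq1 : t / (1 + t) ≤ 1 := by rw [div_le_one h1t]; linarith
  refine ⟨fun _ hp => ?_, fun hp => ?_⟩
  · have hz : t ^ (1 - p₁) * (1 + t) ^ (p₁ - 1) ≤ 1 := by
      rw [hZ]; exact rpow_le_one hq0.le hq1 (by linarith)
    refine (add_le_add a1 a2).trans ?_
    calc _ ≤ C * (Real.log (2 + t) ^ α * 1 * (1 + t) ^ (-β)) +
          D * (Real.log (2 + t) ^ α * (1 + t) ^ (-β)) := by gcongr
      _ = _ := by ring
  · have hz : 1 ≤ t ^ (1 - p₁) * (1 + t) ^ (p₁ - 1) := by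
      rw [hZ]; exact one_le_rpow_of_pos_of_le_one_of_nonpos hq0 hq1 (by linarith)
    refine (add_le_add a1 a2).trans ?_
    rw [show p₁ - 1 - β = (p₁ - 1) + (-β) by ring, rpow_add h1t]
    calc _ ≤ C * (Real.log (2 + t) ^ α * (t ^ (1 - p₁) * (1 + t) ^ (p₁ - 1)) * (1 + t) ^ (-β)) +
          D * (Real.log (2 + t) ^ α * (t ^ (1 - p₁) * (1 + t) ^ (p₁ - 1)) * (1 + t) ^ (-β)) := by
          gcongr
          exact le_mul_of_one_le_right hX.le hz
      _ = _ := by ring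
end

section
/- There exists a constant C > 0 such that for all t ≥ 0, all k ∈ (-1, 1), and all signs ε, η ∈ {+1, -1}, writing Δ = √(1 - k²), one has | e^{-k²t} ( cos(ktΔ) + ε i (1 + η i k) sin(ktΔ)/Δ ) − e^{-k²t + ε i k t} | ≤ C e^{-k²t/2} (1+t)^{-1/2}, where i is the imaginary unit and |·| is the complex modulus. (These four inequalities express that, for frequencies |k| ≤ 1, the Fourier multiplier matrix S e^{Lt} of the linearized p-system, conjugated by S = [[1,1],[1,-1]], is close to the diagonal heat–transport multiplier diag(e^{-k²t+ikt}, e^{-k²t-ikt}) S.) -/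
open MeasureTheory Real Filter


lemma aux_real (t k d : ℝ) (ht : 0 ≤ t) (hk : k^2 < 1) (hd0 : 0 < d) (hd : d^2 = 1 - k^2) :
    (|cos (k*t*d) - cos (k*t)| + |k| * (|sin (k*t*d)| / d) + |sin (k*t*d) / d - sin (k*t)|)
      * √(1+t) ≤ 64 * exp (k^2*t/2) := by
  have hx : 0 ≤ k^2*t := by positivity
  have hexp : 1 + (k^2*t)/2 + (k^2*t)^2/8 ≤ exp (k^2*t/2) := by
    have := Real.quadratic_le_exp_of_nonneg (x := k^2*t/2) (by positivity)
    nlinarith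
  have hd1 : d ≤ 1 := by nlinarith [sq_nonneg k]
  have hka : |k| ≤ 1 := by rw [← sq_le_one_iff_abs_le_one]; exact hk.le
  have hk0 := abs_nonneg k
  have hks : |k|^2 = k^2 := sq_abs k
  have hs1 : |sin (k*t*d)| ≤ 1 := abs_sin_le_one _
  have hs0 := abs_nonneg (sin (k*t*d))
  have hr0 : 0 ≤ √(1+t) := Real.sqrt_nonneg _
  have hr2 : √(1+t)^2 = 1+t := Real.sq_sqrt (by linarith)
  have h1d : 1 - d ≤ k^2 := by nlinarith
  by_cases hc : k^2 ≤ 1/2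
  · have hd2 : 1/2 ≤ d := by nlinarith
    have hdist : |k*t*d - k*t| ≤ |k| * (k^2*t) := by
      have : k*t*d - k*t = -(k * (t * (1-d))) := by ring
      rw [this, abs_neg, abs_mul, abs_of_nonneg (mul_nonneg ht (by linarith : 0 ≤ 1-d))]
      apply mul_le_mul_of_nonneg_left _ hk0
      nlinarith
    have a1 : |cos (k*t*d) - cos (k*t)| ≤ |k| * (k^2*t) :=
      (Real.abs_cos_sub_cos_le _ _).trans hdist
    have a2 : |sin (k*t*d) - sin (k*t)| ≤ |k| * (k^2*t) :=
      (Real.abs_sin_sub_sin_le _ _).trans hdist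
    have a3 : |sin (k*t*d)| / d ≤ 2 := by
      rw [div_le_iff₀ hd0]; linarith
    have a4 : |sin (k*t*d) / d - sin (k*t)| ≤ 2 * |k| + |k| * (k^2*t) := by
      have e : sin (k*t*d) / d - sin (k*t)
          = sin (k*t*d) / d * (1-d) + (sin (k*t*d) - sin (k*t)) := by
        field_simp; ring
      rw [e]
      refine (abs_add_le _ _).trans (add_le_add ?_ a2)
      rw [abs_mul, abs_div, abs_of_pos hd0, abs_of_nonneg (by linarith : 0 ≤ 1-d)]
      apply mul_le_mul a3 _ (by linarith) (by norm_num)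
      nlinarith
    have a5 : |k| * √(1+t) ≤ 1 + k^2*t := by
      apply abs_le_of_sq_le_sq' _ (by positivity) |>.2
      rw [mul_pow, hks, hr2]; nlinarith
    have a6 : |k| * (|sin (k*t*d)| / d) ≤ |k| * 2 := mul_le_mul_of_nonneg_left a3 hk0
    calc _ ≤ (|k| * (k^2*t) + |k| * 2 + (2 * |k| + |k| * (k^2*t))) * √(1+t) := by gcongr
      _ = (2 * (k^2*t) + 4) * (|k| * √(1+t)) := by ring
      _ ≤ (2 * (k^2*t) + 4) * (1 + k^2*t) := by gcongr
      _ ≤ _ := by nlinarith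
  · push Not at hc
    have htx : t ≤ 2 * (k^2*t) := by nlinarith
    have a3 : |sin (k*t*d)| / d ≤ t := by
      rw [div_le_iff₀ hd0]
      refine Real.abs_sin_le_abs.trans ?_
      rw [abs_mul, abs_mul, abs_of_pos hd0, abs_of_nonneg ht]
      have : |k| * t ≤ t := by nlinarith
      gcongr
    have a1 : |cos (k*t*d) - cos (k*t)| ≤ 2 := by
      refine (abs_sub _ _).trans ?_
      linarith [abs_cos_le_one (k*t*d), abs_cos_le_one (k*t)]
    have a4 : |sin (k*t*d) / d - sin (k*t)| ≤ t + 1 := by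
      refine (abs_sub _ _).trans ?_
      rw [abs_div, abs_of_pos hd0]
      linarith [abs_sin_le_one (k*t)]
    have a6 : |k| * (|sin (k*t*d)| / d) ≤ 1 * t := mul_le_mul hka a3 (by positivity) (by norm_num)
    have a5 : √(1+t) ≤ 1 + t := by
      rw [Real.sqrt_le_left (by linarith)]; nlinarith
    calc _ ≤ (2 + 1 * t + (t+1)) * (1+t) := by gcongr
      _ ≤ (2 + 1 * (2*(k^2*t)) + (2*(k^2*t)+1)) * (1+2*(k^2*t)) := by gcongr
      _ ≤ _ := by nlinarith

/-- There is `C > 0` such that for all `t ≥ 0`, `k ∈ (-1,1)` and signs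
`ε, η ∈ {1,-1}`, with `Δ = √(1-k²)`,
`|e^{-k²t}(cos(ktΔ) + ε i (1 + η i k) sin(ktΔ)/Δ) − e^{-k²t + ε i k t}|
  ≤ C e^{-k²t/2} (1+t)^{-1/2}`. -/
theorem stmt_13 :
    ∃ C : ℝ, 0 < C ∧ ∀ t : ℝ, 0 ≤ t → ∀ k : ℝ, k ∈ Set.Ioo (-1:ℝ) 1 →
      ∀ ε η : ℝ, (ε = 1 ∨ ε = -1) → (η = 1 ∨ η = -1) →
        norm
          ((Real.exp (-(k^2 * t)) : ℂ) *
              ((Real.cos (k * t * Real.sqrt (1 - k^2)) : ℂ)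
                + (ε : ℂ) * Complex.I * (1 + (η : ℂ) * Complex.I * (k : ℂ))
                  * (Real.sin (k * t * Real.sqrt (1 - k^2)) : ℂ)
                  / (Real.sqrt (1 - k^2) : ℂ))
            - Complex.exp (-((k:ℂ)^2 * (t:ℂ)) + (ε : ℂ) * Complex.I * (k:ℂ) * (t:ℂ)))
          ≤ C * Real.exp (-(k^2 * t)/2) * (1 + t) ^ (-(1:ℝ)/2) := by
  refine ⟨64, by norm_num, ?_⟩
  intro t ht k hk ε η hε hη
  have hk2 : k^2 < 1 := by nlinarith [hk.1, hk.2]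
  have hd0 : 0 < √(1-k^2) := Real.sqrt_pos.mpr (by linarith)
  have hd : √(1-k^2)^2 = 1 - k^2 := Real.sq_sqrt (by linarith)
  have key := aux_real t k _ ht hk2 hd0 hd
  generalize √(1-k^2) = d at *
  have hεa : |ε| = 1 := by rcases hε with h | h <;> simp [h]
  have hηa : |η| = 1 := by rcases hη with h | h <;> simp [h]
  have hE : Complex.exp (-((k:ℂ)^2 * (t:ℂ)) + (ε : ℂ) * Complex.I * (k:ℂ) * (t:ℂ))
      = (Real.exp (-(k^2 * t)) : ℂ) * ((cos (k*t) : ℝ) + ε * Complex.I * (sin (k*t) : ℝ)) := by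
    rw [Complex.exp_add]
    congr 1
    · push_cast; rfl
    · have e : (ε : ℂ) * Complex.I * (k:ℂ) * (t:ℂ) = ((ε * (k * t) : ℝ) : ℂ) * Complex.I := by
        push_cast; ring
      rw [e, Complex.exp_mul_I, ← Complex.ofReal_cos, ← Complex.ofReal_sin]
      rcases hε with h | h <;> subst h <;> simp [mul_comm]
  have hW : ∀ A B s c S : ℝ, (A : ℂ) * ((c : ℂ) + (ε : ℂ) * Complex.I * (1 + (η : ℂ) * Complex.I * (k : ℂ))
      * (s : ℂ) / (d : ℂ)) - A * ((B : ℂ) + ε * Complex.I * (S : ℂ))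
      = (A : ℂ) * (((c - B - ε * η * k * (s / d) : ℝ) : ℂ) + ((ε * (s / d - S) : ℝ) : ℂ) * Complex.I) := by
    intro A B s c S
    push_cast
    linear_combination (A * ε * η * k * s / d : ℂ) * Complex.I_sq
  rw [hE, hW, norm_mul, Complex.norm_real, Real.norm_of_nonneg (exp_pos _).le]
  have hN : ‖(((cos (k*t*d) - cos (k*t) - ε * η * k * (sin (k*t*d) / d) : ℝ) : ℂ)
      + ((ε * (sin (k*t*d) / d - sin (k*t)) : ℝ) : ℂ) * Complex.I)‖ ≤
      |cos (k*t*d) - cos (k*t)| + |k| * (|sin (k*t*d)| / d) + |sin (k*t*d) / d - sin (k*t)| := by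
    refine (norm_add_le _ _).trans (add_le_add ?_ ?_)
    · rw [Complex.norm_real, Real.norm_eq_abs]
      refine (abs_sub _ _).trans (add_le_add le_rfl ?_)
      rw [abs_mul, abs_mul, abs_mul, hεa, hηa, abs_div, abs_of_pos hd0]; simp
    · rw [norm_mul, Complex.norm_real, Real.norm_eq_abs, abs_mul, hεa]; simp
  have hr : (1+t) ^ (-(1:ℝ)/2) = (√(1+t))⁻¹ := by
    rw [Real.sqrt_eq_rpow, ← Real.rpow_neg (by linarith)]; norm_num
  have hs : 0 < √(1+t) := Real.sqrt_pos.mpr (by linarith)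
  rw [hr, ← div_eq_mul_inv, le_div_iff₀ hs]
  have he : exp (-(k^2*t)/2) = exp (-(k^2*t)) * exp (k^2*t/2) := by
    rw [← Real.exp_add]; ring_nf
  rw [he]
  have h2 := (mul_le_mul_of_nonneg_right hN hs.le).trans key
  have h3 := mul_le_mul_of_nonneg_left h2 (exp_pos (-(k^2*t))).le
  calc _ = exp (-(k^2*t)) * (_ * √(1+t)) := mul_assoc _ _ _
    _ ≤ _ := h3
    _ = _ := by ring
end

section
/- There exists a constant C > 0 such that for all k with 0 < |k| < 1 and Δ = √(1 - k²): (i) e^{-k²t} |sin(ktΔ)|/Δ ≤ C e^{-k²t/4} for all t ≥ 0; (ii) e^{-k²t} |k| |sin(ktΔ)|/Δ ≤ C e^{-k²t/4} for all t ≥ 0; (iii) e^{-k²t} |k| |sin(ktΔ)|/Δ ≤ C t^{-1/2} e^{-k²t/4} for all t > 0. -/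
open MeasureTheory Real Filter

theorem aux_exp (x : ℝ) (hx : 0 ≤ x) : Real.exp (-x) * (1 + x)^2 ≤ 8 * Real.exp (-x/4) := by
  have h1 : Real.exp (-x/4) = Real.exp (-x) * (Real.exp (3*x/8))^2 := by
    rw [sq, ← Real.exp_add, ← Real.exp_add]; congr 1; ring
  have h2 : 3*x/8 + 1 ≤ Real.exp (3*x/8) := Real.add_one_le_exp _
  have h3 : (3*x/8+1)^2 ≤ (Real.exp (3*x/8))^2 := pow_le_pow_left₀ (by positivity) h2 2
  rw [h1]
  have h4 : (1+x)^2 ≤ 8 * (Real.exp (3*x/8))^2 := by nlinarith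
  have := mul_le_mul_of_nonneg_left h4 (Real.exp_pos (-x)).le
  linarith

theorem aux_sin (k : ℝ) (h1 : |k| < 1) (t : ℝ) (ht : 0 ≤ t) :
    |Real.sin (k * t * Real.sqrt (1 - k^2))| / Real.sqrt (1 - k^2) ≤ 2 * (1 + k^2 * t) := by
  have hk : k^2 = |k|^2 := (sq_abs k).symm
  have h0 := abs_nonneg k
  have hp : 0 < 1 - k^2 := by rw [hk]; nlinarith
  have hd : 0 < Real.sqrt (1 - k^2) := Real.sqrt_pos.2 hp
  have hx : 0 ≤ k^2 * t := by positivity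
  rw [div_le_iff₀ hd]
  rcases le_total |k| (1/2) with h | h
  · have hd2 : 1/2 ≤ Real.sqrt (1 - k^2) := by
      apply Real.le_sqrt_of_sq_le; rw [hk]; nlinarith
    have := Real.abs_sin_le_one (k * t * Real.sqrt (1 - k^2))
    nlinarith
  · have h3 : |Real.sin (k * t * Real.sqrt (1 - k^2))| ≤ |k * t * Real.sqrt (1 - k^2)| :=
      Real.abs_sin_le_abs
    rw [abs_mul, abs_mul, abs_of_nonneg ht, abs_of_pos hd] at h3
    refine h3.trans (mul_le_mul_of_nonneg_right ?_ hd.le)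
    have : |k| ≤ 2 * k^2 := by rw [hk]; nlinarith
    nlinarith

/-- low-frequency bounds on the semigroup entries: there is `C > 0` such that
for all `0 < |k| < 1`, with `Δ = √(1-k²)`: (i) `e^{-k²t}|sin(ktΔ)|/Δ ≤ C e^{-k²t/4}` for
`t ≥ 0`; (ii) `e^{-k²t}|k||sin(ktΔ)|/Δ ≤ C e^{-k²t/4}` for `t ≥ 0`;
(iii) `e^{-k²t}|k||sin(ktΔ)|/Δ ≤ C t^{-1/2} e^{-k²t/4}` for `t > 0`. -/
theorem stmt_14 :
    ∃ C : ℝ, 0 < C ∧ ∀ k : ℝ, 0 < |k| → |k| < 1 →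
      (∀ t : ℝ, 0 ≤ t →
        Real.exp (-(k^2 * t)) * |Real.sin (k * t * Real.sqrt (1 - k^2))|
            / Real.sqrt (1 - k^2)
          ≤ C * Real.exp (-(k^2 * t)/4)) ∧
      (∀ t : ℝ, 0 ≤ t →
        Real.exp (-(k^2 * t)) * |k| * |Real.sin (k * t * Real.sqrt (1 - k^2))|
            / Real.sqrt (1 - k^2)
          ≤ C * Real.exp (-(k^2 * t)/4)) ∧
      (∀ t : ℝ, 0 < t →
        Real.exp (-(k^2 * t)) * |k| * |Real.sin (k * t * Real.sqrt (1 - k^2))|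
            / Real.sqrt (1 - k^2)
          ≤ C * t ^ (-(1:ℝ)/2) * Real.exp (-(k^2 * t)/4)) := by
  refine ⟨16, by norm_num, fun k _ h1 => ?_⟩
  have key : ∀ t : ℝ, 0 ≤ t → Real.exp (-(k^2 * t)) *
      (|Real.sin (k * t * Real.sqrt (1 - k^2))| / Real.sqrt (1 - k^2)) * (1 + k^2*t)
        ≤ 16 * Real.exp (-(k^2 * t)/4) := by
    intro t ht
    have hx : 0 ≤ k^2 * t := by positivity
    calc _ ≤ Real.exp (-(k^2 * t)) * (2 * (1 + k^2 * t)) * (1 + k^2*t) := by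
          gcongr; exact aux_sin k h1 t ht
      _ = 2 * (Real.exp (-(k^2 * t)) * (1 + k^2*t)^2) := by ring
      _ ≤ _ := by linarith [aux_exp _ hx]
  have gen : ∀ t a : ℝ, 0 ≤ t → a ≤ 1 + k^2*t → Real.exp (-(k^2 * t)) * a *
      |Real.sin (k * t * Real.sqrt (1 - k^2))| / Real.sqrt (1 - k^2)
        ≤ 16 * Real.exp (-(k^2 * t)/4) := by
    intro t a ht ha
    refine le_trans ?_ (key t ht)
    have := mul_le_mul_of_nonneg_left ha (show 0 ≤ Real.exp (-(k^2 * t)) *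
      (|Real.sin (k * t * Real.sqrt (1 - k^2))| / Real.sqrt (1 - k^2)) by positivity)
    refine le_trans (le_of_eq ?_) this
    ring
  refine ⟨fun t ht => ?_, fun t ht => ?_, fun t ht => ?_⟩
  · have hx : 0 ≤ k^2 * t := by positivity
    simpa using gen t 1 ht (by linarith)
  · have hx : 0 ≤ k^2 * t := by positivity
    exact gen t |k| ht (by linarith)
  · have hs : 0 < Real.sqrt t := Real.sqrt_pos.2 ht
    have hr : t ^ (-(1:ℝ)/2) = (Real.sqrt t)⁻¹ := by
      rw [Real.sqrt_eq_rpow, ← Real.rpow_neg ht.le]; norm_num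
    have hg := gen t (|k| * Real.sqrt t) ht.le (by
      have : k^2 * t = (|k| * Real.sqrt t)^2 := by
        rw [mul_pow, sq_abs, Real.sq_sqrt ht.le]
      rw [this]; nlinarith [sq_nonneg (|k| * Real.sqrt t - 1), sq_nonneg (|k| * Real.sqrt t)])
    have e : 16 * t ^ (-(1:ℝ)/2) * Real.exp (-(k^2 * t)/4)
        = (16 * Real.exp (-(k^2 * t)/4)) / Real.sqrt t := by rw [hr]; ring
    rw [e, le_div_iff₀ hs]
    refine le_trans (le_of_eq ?_) hg
    ring
end

section
/- There exists a constant C > 0 such that for all k with |k| > 1 and μ = √(k² - 1), and all t ≥ 0: (i) e^{-k²t} cosh(|k| t μ) ≤ C e^{-t/4}; (ii) e^{-k²t} (|k|/μ) sinh(|k| t μ) ≤ C e^{-t/4}; (iii) e^{-k²t} sinh(|k| t μ)/μ ≤ C e^{-t/4} / √(1 + k²). -/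
open MeasureTheory Real Filter

theorem aux_sinh (x : ℝ) : Real.sinh x ≤ x * Real.exp x := by
  rw [Real.sinh_eq]
  have h := Real.add_one_le_exp (-(2 * x))
  have h2 : Real.exp (-x) = Real.exp x * Real.exp (-(2 * x)) := by
    rw [← Real.exp_add]; congr 1; ring
  have h3 := mul_le_mul_of_nonneg_left h (Real.exp_pos x).le
  rw [h2]; linarith

theorem aux_sinh' (x : ℝ) : Real.sinh x ≤ Real.exp x := by
  rw [Real.sinh_eq]
  linarith [Real.exp_pos x, Real.exp_pos (-x)]

theorem aux_ii (a m t : ℝ) (ha : 1 < a) (hm : 0 < m) (h : m ^ 2 = a ^ 2 - 1) (ht : 0 ≤ t) :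
    Real.exp (-(a ^ 2 * t)) * (a / m) * Real.sinh (a * t * m) ≤ 4 * Real.exp (-t / 4) := by
  have hma : m < a := by nlinarith
  have hgap : 1 / 2 ≤ a ^ 2 - a * m := by nlinarith [sq_nonneg (a - m)]
  rcases le_total a (2 * m) with h1 | h1
  · have hq : a / m ≤ 2 := by rw [div_le_iff₀ hm]; exact h1
    have he : Real.exp (-(a ^ 2 * t)) * Real.exp (a * t * m) ≤ Real.exp (-t / 4) := by
      rw [← Real.exp_add]; apply Real.exp_le_exp.mpr; nlinarith [mul_le_mul_of_nonneg_right hgap ht]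
    have hp : 0 < a / m := by positivity
    calc _ ≤ Real.exp (-(a ^ 2 * t)) * (a / m) * Real.exp (a * t * m) := by
          gcongr; exact aux_sinh' _
      _ = (a / m) * (Real.exp (-(a ^ 2 * t)) * Real.exp (a * t * m)) := by ring
      _ ≤ 4 * Real.exp (-t / 4) := by
          apply mul_le_mul (by linarith) he (by positivity) (by norm_num)
  · have he : Real.exp (-(a ^ 2 * t)) * Real.exp (a * t * m) ≤ Real.exp (-(a ^ 2 * t) / 2) := by
      rw [← Real.exp_add]; apply Real.exp_le_exp.mpr
      have : 0 ≤ a * t * (a - 2 * m) := by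
        apply mul_nonneg (by positivity); linarith
      nlinarith
    have h4 : a ^ 2 * t ≤ 4 * Real.exp (a ^ 2 * t / 4) := by
      linarith [Real.add_one_le_exp (a ^ 2 * t / 4)]
    calc _ ≤ Real.exp (-(a ^ 2 * t)) * (a / m) * (a * t * m * Real.exp (a * t * m)) := by
          gcongr; exact aux_sinh _
      _ = (a ^ 2 * t) * (Real.exp (-(a ^ 2 * t)) * Real.exp (a * t * m)) := by
          field_simp
      _ ≤ (4 * Real.exp (a ^ 2 * t / 4)) * Real.exp (-(a ^ 2 * t) / 2) := by
          apply mul_le_mul h4 he (by positivity) (by positivity)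
      _ = 4 * Real.exp (-(a ^ 2 * t) / 4) := by
          rw [mul_assoc, ← Real.exp_add]; congr 2; ring
      _ ≤ 4 * Real.exp (-t / 4) := by
          gcongr; nlinarith

/-- high-frequency bounds on the semigroup entries: there is `C > 0` such that
for all `|k| > 1`, with `μ = √(k²-1)`, and all `t ≥ 0`:
(i) `e^{-k²t} cosh(|k|tμ) ≤ C e^{-t/4}`;
(ii) `e^{-k²t} (|k|/μ) sinh(|k|tμ) ≤ C e^{-t/4}`;
(iii) `e^{-k²t} sinh(|k|tμ)/μ ≤ C e^{-t/4}/√(1+k²)`. -/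
theorem stmt_15 :
    ∃ C : ℝ, 0 < C ∧ ∀ k : ℝ, 1 < |k| → ∀ t : ℝ, 0 ≤ t →
      (Real.exp (-(k^2 * t)) * Real.cosh (|k| * t * Real.sqrt (k^2 - 1))
        ≤ C * Real.exp (-t/4)) ∧
      (Real.exp (-(k^2 * t)) * (|k| / Real.sqrt (k^2 - 1))
          * Real.sinh (|k| * t * Real.sqrt (k^2 - 1))
        ≤ C * Real.exp (-t/4)) ∧
      (Real.exp (-(k^2 * t)) * Real.sinh (|k| * t * Real.sqrt (k^2 - 1))
          / Real.sqrt (k^2 - 1)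
        ≤ C * Real.exp (-t/4) / Real.sqrt (1 + k^2)) := by
  refine ⟨8, by norm_num, fun k hk t ht => ?_⟩
  rw [← sq_abs k]
  generalize |k| = a at *
  have hpos : 0 < a ^ 2 - 1 := by nlinarith
  have hm : 0 < Real.sqrt (a ^ 2 - 1) := Real.sqrt_pos.mpr hpos
  have h : Real.sqrt (a ^ 2 - 1) ^ 2 = a ^ 2 - 1 := Real.sq_sqrt hpos.le
  generalize Real.sqrt (a ^ 2 - 1) = m at *
  have h2 := aux_ii a m t hk hm h ht
  have hE := Real.exp_pos (-t / 4)
  refine ⟨?_, by linarith, ?_⟩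
  · have hgap : 1 / 2 ≤ a ^ 2 - a * m := by nlinarith [sq_nonneg (a - m)]
    have hx : 0 ≤ a * t * m := by positivity
    have hc : Real.cosh (a * t * m) ≤ Real.exp (a * t * m) := by
      rw [Real.cosh_eq]
      have : Real.exp (-(a * t * m)) ≤ Real.exp (a * t * m) := Real.exp_le_exp.mpr (by linarith)
      linarith
    have he : Real.exp (-(a ^ 2 * t)) * Real.exp (a * t * m) ≤ Real.exp (-t / 4) := by
      rw [← Real.exp_add]; apply Real.exp_le_exp.mpr; nlinarith [mul_le_mul_of_nonneg_right hgap ht]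
    have := mul_le_mul_of_nonneg_left hc (Real.exp_pos (-(a ^ 2 * t))).le
    linarith
  · have hs : Real.sqrt (1 + a ^ 2) ≤ 2 * a := by
      rw [Real.sqrt_le_left (by linarith)]; nlinarith
    have hsp : 0 < Real.sqrt (1 + a ^ 2) := Real.sqrt_pos.mpr (by positivity)
    have hsh : 0 ≤ Real.sinh (a * t * m) := Real.sinh_nonneg_iff.mpr (by positivity)
    rw [le_div_iff₀ hsp]
    calc _ ≤ Real.exp (-(a ^ 2 * t)) * Real.sinh (a * t * m) / m * (2 * a) := by gcongr
      _ = 2 * (Real.exp (-(a ^ 2 * t)) * (a / m) * Real.sinh (a * t * m)) := by ring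
      _ ≤ _ := by linarith
end
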